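/- arXiv:2010.10672 — 3 statements merged into one kernel-verified Lean document; each statement's English description precedes it below -/
import Mathlib

section
/- Consider the broadcast process on the infinite rooted d-regular tree, conditioned on the root label σ_ρ = 1, and assume λ²d > 1. Setting R = p(2 − p − p/(q−1)), for every k ≥ 1 and every label i ≠ 1 one has Var(Z_{ρ,k}) < R d^k ((λ²d)^k − 1)/(λ²d − 1) and Var(Y^{(i)}_{ρ,k}) < R d^k ((λ²d)^k − 1)/(λ²d − 1). -/
open MeasureTheory ProbabilityTheory Filter

/-- Transition matrix of the broadcast process. -/
noncomputable def transM (q : ℕ) (p : ℝ) (a b : Fin q) : ℝ :=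
  if a = b then 1 - p else p / ((q : ℝ) - 1)

/-- The number of vertices at depth `k` of the `d`-regular tree whose label is `i`. -/
def levelCount {Ω : Type} (q d : ℕ) (σ : List (Fin d) → Ω → Fin q) (i : Fin q) (k : ℕ)
    (ω : Ω) : ℕ :=
  (Finset.univ.filter (fun f : Fin k → Fin d => σ (List.ofFn f) ω = i)).card

theorem sum_prod_mul_sq {U C : Type*} [Fintype U] [DecidableEq U] [Fintype C] (w h : U → C → ℝ)
    (hw : ∀ u, ∑ c, w u c = 1) (hh : ∀ u, ∑ c, w u c * h u c = 0) (s : ℝ) :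
    ∑ m : U → C, (∏ u, w u (m u)) * (∑ u, h u (m u) + s) ^ 2
      = ∑ u, ∑ c, w u c * h u c ^ 2 + s ^ 2 := by
  have marg (g : U → C → ℝ) : ∑ m : U → C, (∏ u, w u (m u)) * ∏ u, g u (m u)
      = ∏ u, ∑ c, w u c * g u c := by
    simp_rw [← Finset.prod_mul_distrib]
    exact (Fintype.prod_sum fun u c => w u c * g u c).symm
  have total : ∑ m : U → C, ∏ u, w u (m u) = 1 := by
    simpa [hw] using marg fun _ _ => 1
  have single (u : U) (g : C → ℝ) :
      ∑ m : U → C, (∏ x, w x (m x)) * g (m u) = ∑ c, w u c * g c := by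
    have := marg fun x c => if x = u then g c else 1
    rw [Finset.prod_eq_single u (by intro b _ hb; simp [hb, hw]) (by simp)] at this
    simpa using this
  have pair (u v : U) : ∑ m : U → C, (∏ x, w x (m x)) * (h u (m u) * h v (m v))
      = if u = v then ∑ c, w u c * h u c ^ 2 else 0 := by
    split_ifs with huv
    · subst huv
      simpa [sq] using single u fun c => h u c * h u c
    · have := marg fun x c => (if x = u then h u c else 1) * (if x = v then h v c else 1)
      rw [Finset.prod_eq_zero (i := u) (Finset.mem_univ u) (by simp [huv, hh])] at this
      simpa only [Finset.prod_mul_distrib, Finset.prod_ite_eq', Finset.mem_univ, if_true] using this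
  have expand (m : U → C) : (∏ u, w u (m u)) * (∑ u, h u (m u) + s) ^ 2
      = ∑ u, ∑ v, (∏ x, w x (m x)) * (h u (m u) * h v (m v))
        + 2 * s * ∑ u, (∏ x, w x (m x)) * h u (m u) + s ^ 2 * ∏ x, w x (m x) := by
    simp_rw [← Finset.mul_sum, ← Finset.sum_mul]
    ring
  simp_rw [expand, Finset.sum_add_distrib, ← Finset.mul_sum (s := (Finset.univ : Finset (U → C)))]
  rw [Finset.sum_comm, total, Finset.sum_comm (γ := U → C)]
  simp_rw [single _ (h _), hh]
  simp_rw [Finset.sum_comm (s := (Finset.univ : Finset (U → C))), pair]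
  simp


theorem integral_comp_eq_sum {Ω α : Type*} [MeasurableSpace Ω] [MeasurableSpace α]
    [MeasurableSingletonClass α] [Fintype α] {ν : Measure Ω} [IsFiniteMeasure ν] {X : Ω → α}
    (hX : Measurable X) (G : α → ℝ) : ∫ ω, G (X ω) ∂ν = ∑ x, ν.real (X ⁻¹' {x}) * G x := by
  rw [← integral_map (f := G) hX.aemeasurable (Measurable.of_discrete.aestronglyMeasurable),
    integral_fintype Integrable.of_finite]
  exact Finset.sum_congr rfl fun x _ => by
    rw [map_measureReal_apply hX (measurableSet_singleton x), smul_eq_mul]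

theorem variance_count_le_of_markov {Ω V I C : Type*} [MeasurableSpace Ω] {ν : Measure Ω}
    [IsProbabilityMeasure ν] [Fintype V] [DecidableEq V] [Fintype I] [DecidableEq I] [Fintype C]
    [DecidableEq C] [MeasurableSpace C] [MeasurableSingletonClass C]
    {X : Ω → V → C} {Y : Ω → V × I → C} (hX : Measurable X) (hY : Measurable Y)
    (K : C → C → ℝ) (hK : ∀ a, ∑ c, K a c = 1) (b : C) (lam β r : ℝ)
    (hKb : ∀ a, K a b = lam * (if a = b then 1 else 0) + β)
    (hr : ∀ a, K a b * (1 - K a b) ≤ r)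
    (hXY : ∀ m m', ν.real (X ⁻¹' {m} ∩ Y ⁻¹' {m'})
      = ν.real (X ⁻¹' {m}) * ∏ u, K (m u.1) (m' u)) :
    Var[fun ω => ∑ u, if Y ω u = b then (1 : ℝ) else 0; ν]
      ≤ (Fintype.card I * lam) ^ 2 * Var[fun ω => ∑ v, if X ω v = b then (1 : ℝ) else 0; ν]
        + Fintype.card V * Fintype.card I * r := by
  set n : (V → C) → ℝ := fun m => ∑ v, if m v = b then 1 else 0 with hn
  set N : (V × I → C) → ℝ := fun m => ∑ u, if m u = b then 1 else 0 with hN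
  have hnX : Measurable fun ω => n (X ω) := (Measurable.of_discrete (f := n)).comp hX
  have hNY : Measurable fun ω => N (Y ω) := (Measurable.of_discrete (f := N)).comp hY
  set e : ℝ := ∫ ω, n (X ω) ∂ν with he
  set c : ℝ := Fintype.card I * (lam * e + Fintype.card V * β) with hc
  have inner (m : V → C) : ∑ m' : V × I → C, (∏ u, K (m u.1) (m' u)) * (N m' - c) ^ 2
      ≤ (Fintype.card I * lam) ^ 2 * (n m - e) ^ 2 + Fintype.card V * Fintype.card I * r := by
    have key := sum_prod_mul_sq (fun (u : V × I) x => K (m u.1) x)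
      (fun u x => (if x = b then 1 else 0) - K (m u.1) b) (fun u => hK _)
      (fun u => by simp [mul_sub, Finset.sum_sub_distrib, ← Finset.sum_mul, hK])
      (Fintype.card I * lam * (n m - e))
    have hsum : ∑ u : V × I, K (m u.1) b - c = Fintype.card I * lam * (n m - e) := by
      rw [Fintype.sum_prod_type]
      dsimp only
      simp only [hKb, Finset.sum_add_distrib, Finset.sum_const, Finset.card_univ, nsmul_eq_mul,
        hn, hc]
      simp only [← Finset.mul_sum]
      ring
    have hvar (u : V × I) : ∑ x, K (m u.1) x * ((if x = b then 1 else 0) - K (m u.1) b) ^ 2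
        = K (m u.1) b * (1 - K (m u.1) b) := by
      have : ∀ x, K (m u.1) x * ((if x = b then 1 else 0) - K (m u.1) b) ^ 2
          = (if x = b then K (m u.1) x * (1 - 2 * K (m u.1) b) else 0)
            + K (m u.1) x * K (m u.1) b ^ 2 := by
        intro x; split_ifs <;> ring
      simp_rw [this, Finset.sum_add_distrib, ← Finset.sum_mul, hK]
      simp
      ring
    calc _ = ∑ u : V × I, K (m u.1) b * (1 - K (m u.1) b)
          + (Fintype.card I * lam * (n m - e)) ^ 2 := by
          simp_rw [hvar] at key
          rw [← key]
          refine Finset.sum_congr rfl fun m' _ => ?_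
          rw [← hsum, Finset.sum_sub_distrib]
          simp only [hN]
          ring
      _ ≤ ∑ u : V × I, r + (Fintype.card I * lam * (n m - e)) ^ 2 := by
          gcongr with u
          exact hr _
      _ = _ := by simp; ring
  have hXYm : Measurable fun ω => (X ω, Y ω) := hX.prodMk hY
  calc Var[fun ω => N (Y ω); ν] = Var[fun ω => N (Y ω) - c; ν] :=
        (variance_sub_const hNY.aestronglyMeasurable c).symm
    _ ≤ ∫ ω, (N (Y ω) - c) ^ 2 ∂ν :=
        variance_le_expectation_sq (hNY.sub_const c).aestronglyMeasurable
    _ = ∑ m, ν.real (X ⁻¹' {m}) * ∑ m', (∏ u, K (m u.1) (m' u)) * (N m' - c) ^ 2 := by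
        rw [integral_comp_eq_sum hXYm fun x => (N x.2 - c) ^ 2, Fintype.sum_prod_type]
        refine Finset.sum_congr rfl fun m _ => ?_
        rw [Finset.mul_sum]
        refine Finset.sum_congr rfl fun m' _ => ?_
        rw [← mul_assoc, ← hXY, ← Set.singleton_prod_singleton, Set.mk_preimage_prod]
    _ ≤ ∑ m, ν.real (X ⁻¹' {m}) * ((Fintype.card I * lam) ^ 2 * (n m - e) ^ 2
          + Fintype.card V * Fintype.card I * r) := by
        gcongr with m
        exact inner m
    _ = (Fintype.card I * lam) ^ 2 * ∫ ω, (n (X ω) - e) ^ 2 ∂ν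
          + Fintype.card V * Fintype.card I * r := by
        rw [integral_comp_eq_sum hX fun m => (n m - e) ^ 2, Finset.mul_sum]
        have := integral_comp_eq_sum (ν := ν) hX fun _ => (1 : ℝ)
        simp only [integral_const, probReal_univ, smul_eq_mul, mul_one] at this
        simp_rw [mul_add, Finset.sum_add_distrib, ← Finset.sum_mul, ← this, one_mul]
        congr 1
        exact Finset.sum_congr rfl fun m _ => by ring
    _ = _ := by rw [variance_eq_integral hnX.aemeasurable]

theorem transM_sum {q : ℕ} (hq : 3 ≤ q) (p : ℝ) (a : Fin q) : ∑ c, transM q p a c = 1 := by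
  have hq' : (3 : ℝ) ≤ q := by exact_mod_cast hq
  have h (c : Fin q) : transM q p a c
      = (if a = c then 1 - p - p / ((q : ℝ) - 1) else 0) + p / ((q : ℝ) - 1) := by
    unfold transM; split_ifs <;> ring
  have : (q : ℝ) - 1 ≠ 0 := by linarith
  simp_rw [h, Finset.sum_add_distrib]
  simp
  field_simp
  ring

theorem transM_mul_one_sub_lt {q : ℕ} (hq : 3 ≤ q) {p : ℝ} (hp0 : 0 < p) (hp1 : p < 1)
    (a b : Fin q) :
    transM q p a b * (1 - transM q p a b) < p * (2 - p - p / ((q : ℝ) - 1)) := by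
  have hq' : (3 : ℝ) ≤ q := by exact_mod_cast hq
  have hx0 : 0 < p / ((q : ℝ) - 1) := by apply div_pos <;> linarith
  have hx1 : p / ((q : ℝ) - 1) < p := div_lt_self hp0 (by linarith)
  unfold transM
  set x := p / ((q : ℝ) - 1)
  split_ifs <;> nlinarith

/-- Given the labels up to depth `k`, the labels at depth `k + 1` are independent transitions. -/
theorem measureReal_inter_children {Ω : Type} {q d : ℕ} [MeasurableSpace Ω] {μ : Measure Ω}
    [IsProbabilityMeasure μ] {p : ℝ} {σ : List (Fin d) → Ω → Fin q} (hmeas : ∀ v, Measurable (σ v))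
    (hlaw : ∀ (k : ℕ) (ℓ : List (Fin d) → Fin q),
      (μ {ω | ∀ v : List (Fin d), v.length ≤ k → σ v ω = ℓ v}).toReal
        = ((q : ℝ))⁻¹ * ∏ j ∈ Finset.range k, ∏ f : Fin j → Fin d, ∏ i : Fin d,
            transM q p (ℓ (List.ofFn f)) (ℓ (i :: List.ofFn f)))
    (k : ℕ) {S : Set Ω}
    (hS : ∀ ω ω', (∀ v : List (Fin d), v.length ≤ k → σ v ω' = σ v ω) → ω ∈ S → ω' ∈ S)
    (m : (Fin k → Fin d) → Fin q) (hm : ∀ ω ∈ S, ∀ f, σ (List.ofFn f) ω = m f)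
    (m' : (Fin k → Fin d) × Fin d → Fin q) :
    μ.real (S ∩ {ω | ∀ u, σ (u.2 :: List.ofFn u.1) ω = m' u})
      = μ.real S * ∏ u, transM q p (m u.1) (m' u) := by
  classical
  set T : Set (List (Fin d)) := {v | v.length ≤ k}
  have : Finite T := List.finite_length_le _ k
  let _ : Fintype T := Fintype.ofFinite T
  let Φ : Ω → T → Fin q := fun ω v => σ v ω
  have hΦ : Measurable Φ := measurable_pi_lambda _ fun v => hmeas v
  have decomp (A : Set Ω) : μ.real A = ∑ x, μ.real (Φ ⁻¹' {x} ∩ A) := by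
    have := sum_measureReal_preimage_singleton (μ := μ.restrict A) Finset.univ (f := Φ)
      fun x _ => hΦ (measurableSet_singleton x)
    simp_rw [measureReal_restrict_apply (hΦ (measurableSet_singleton _))] at this
    rw [this]
    simp
  rw [decomp, decomp S, Finset.sum_mul]
  refine Finset.sum_congr rfl fun x _ => ?_
  rcases (Φ ⁻¹' {x} ∩ S).eq_empty_or_nonempty with hE | ⟨ω₀, hω₀, hS₀⟩
  · simp [← Set.inter_assoc, hE]
  have hx {ω : Ω} : ω ∈ Φ ⁻¹' {x} ↔ ∀ v : List (Fin d), v.length ≤ k → σ v ω = σ v ω₀ := by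
    rw [Set.mem_preimage, Set.mem_singleton_iff, ← (hω₀ : Φ ω₀ = x), funext_iff]
    exact ⟨fun h v hv => h ⟨v, hv⟩, fun h v => h v v.2⟩
  let ℓ : List (Fin d) → Fin q
    | [] => σ [] ω₀
    | i :: t => if h : t.length = k then m' (fun j => t.get (j.cast h.symm), i) else σ (i :: t) ω₀
  have hℓ_le (v : List (Fin d)) (hv : v.length ≤ k) : ℓ v = σ v ω₀ := by
    cases v with
    | nil => rfl
    | cons i t =>
      simp only [List.length_cons] at hv
      exact dif_neg (by omega)
  have hℓ_succ (u : (Fin k → Fin d) × Fin d) : ℓ (u.2 :: List.ofFn u.1) = m' u := by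
    simp only [ℓ]
    rw [dif_pos (List.length_ofFn)]
    congr 1
    ext <;> simp
  have h1 : Φ ⁻¹' {x} ∩ S = {ω | ∀ v : List (Fin d), v.length ≤ k → σ v ω = ℓ v} := by
    ext ω
    rw [Set.mem_inter_iff, hx]
    constructor
    · rintro ⟨h, -⟩ v hv
      rw [h v hv, hℓ_le v hv]
    · intro h
      have h' : ∀ v : List (Fin d), v.length ≤ k → σ v ω = σ v ω₀ :=
        fun v hv => (h v hv).trans (hℓ_le v hv)
      exact ⟨h', hS ω₀ ω h' hS₀⟩
  have h2 : Φ ⁻¹' {x} ∩ (S ∩ {ω | ∀ u, σ (u.2 :: List.ofFn u.1) ω = m' u})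
      = {ω | ∀ v : List (Fin d), v.length ≤ k + 1 → σ v ω = ℓ v} := by
    ext ω
    rw [← Set.inter_assoc, h1]
    constructor
    · rintro ⟨h, h'⟩ v hv
      rcases Nat.le_succ_iff.mp hv with hv | hv
      · exact h v hv
      · cases v with
        | nil => simp at hv
        | cons i t =>
          simp only [List.length_cons, Nat.succ_eq_add_one, add_left_inj] at hv
          subst hv
          have := h' (t.get, i)
          rw [← hℓ_succ] at this
          simpa only [List.ofFn_get] using this
    · intro h
      exact ⟨fun v hv => h v (by omega), fun u => (h _ (by simp)).trans (hℓ_succ u)⟩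
  rw [h1, h2, measureReal_def, measureReal_def, hlaw, hlaw, Finset.prod_range_succ, ← mul_assoc]
  congr 1
  rw [Fintype.prod_prod_type]
  refine Finset.prod_congr rfl fun f _ => Finset.prod_congr rfl fun i _ => ?_
  rw [hℓ_succ (f, i), hℓ_le _ (by simp), hm ω₀ hS₀ f]

theorem levelCount_eq_sum {Ω : Type} {q d : ℕ} (σ : List (Fin d) → Ω → Fin q) (b : Fin q) (k : ℕ)
    (ω : Ω) : (levelCount q d σ b k ω : ℝ)
      = ∑ f : Fin k → Fin d, if σ (List.ofFn f) ω = b then 1 else 0 := by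
  simp [levelCount]

theorem levelCount_succ_eq_sum {Ω : Type} {q d : ℕ} (σ : List (Fin d) → Ω → Fin q) (b : Fin q)
    (k : ℕ) (ω : Ω) : (levelCount q d σ b (k + 1) ω : ℝ)
      = ∑ u : (Fin k → Fin d) × Fin d, if σ (u.2 :: List.ofFn u.1) ω = b then 1 else 0 := by
  rw [levelCount_eq_sum]
  refine (Fintype.sum_equiv ((Equiv.prodComm _ _).trans (Fin.consEquiv fun _ => Fin d)) _ _ ?_).symm
  intro u
  simp [Fin.consEquiv]

theorem variance_levelCount_le {Ω : Type} {q d : ℕ} (hq : 3 ≤ q) [MeasurableSpace Ω]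
    {μ : Measure Ω} [IsProbabilityMeasure μ] {p : ℝ} {σ : List (Fin d) → Ω → Fin q}
    (hmeas : ∀ v, Measurable (σ v))
    (hlaw : ∀ (k : ℕ) (ℓ : List (Fin d) → Fin q),
      (μ {ω | ∀ v : List (Fin d), v.length ≤ k → σ v ω = ℓ v}).toReal
        = ((q : ℝ))⁻¹ * ∏ j ∈ Finset.range k, ∏ f : Fin j → Fin d, ∏ i : Fin d,
            transM q p (ℓ (List.ofFn f)) (ℓ (i :: List.ofFn f)))
    (a b : Fin q) {r : ℝ} (hr : ∀ c, transM q p c b * (1 - transM q p c b) ≤ r) (k : ℕ) :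
    Var[fun ω => (levelCount q d σ b k ω : ℝ); μ[|{ω | σ [] ω = a}]]
      ≤ r * (d : ℝ) ^ k
        * ∑ j ∈ Finset.range k, ((1 - p * q / ((q : ℝ) - 1)) ^ 2 * d) ^ j := by
  have hq' : (3 : ℝ) ≤ q := by exact_mod_cast hq
  have hroot : MeasurableSet {ω | σ [] ω = a} := hmeas [] (measurableSet_singleton a)
  have hroot0 : μ {ω | σ [] ω = a} ≠ 0 := by
    intro h0
    have := hlaw 0 fun _ => a
    simp only [Nat.le_zero, List.length_eq_zero_iff, forall_eq, h0] at this
    have : (0 : ℝ) = q := by simpa using this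
    linarith
  have : IsProbabilityMeasure μ[|{ω | σ [] ω = a}] := cond_isProbabilityMeasure hroot0
  induction k with
  | zero =>
    have : (fun ω => (levelCount q d σ b 0 ω : ℝ)) =ᵐ[μ[|{ω | σ [] ω = a}]]
        fun _ => if a = b then 1 else 0 := by
      filter_upwards [ae_cond_mem hroot] with ω hω
      rw [levelCount_eq_sum]
      simp [(hω : σ [] ω = a)]
    rw [variance_congr this, variance_eq_integral aemeasurable_const]
    simp
  | succ k ih =>
    let X : Ω → (Fin k → Fin d) → Fin q := fun ω f => σ (List.ofFn f) ω
    let Y : Ω → (Fin k → Fin d) × Fin d → Fin q := fun ω u => σ (u.2 :: List.ofFn u.1) ω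
    have step := variance_count_le_of_markov (ν := μ[|{ω | σ [] ω = a}]) (X := X) (Y := Y)
      (measurable_pi_lambda _ fun _ => hmeas _) (measurable_pi_lambda _ fun _ => hmeas _)
      (transM q p) (transM_sum hq p) b (1 - p * q / ((q : ℝ) - 1)) (p / ((q : ℝ) - 1)) r
      (fun c => by
        have : (q : ℝ) - 1 ≠ 0 := by linarith
        unfold transM
        split_ifs
        · field_simp; ring
        · ring) hr
      (fun m m' => by
        have h := measureReal_inter_children hmeas hlaw k (S := {ω | σ [] ω = a} ∩ X ⁻¹' {m})
          (by
            rintro ω ω' h ⟨h1, h2⟩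
            refine ⟨(h [] (by simp)).trans h1, ?_⟩
            rw [Set.mem_preimage, Set.mem_singleton_iff] at h2 ⊢
            rw [← h2]
            exact funext fun f => h _ (by simp)) m
          (fun ω hω f => congrFun hω.2 f) m'
        have hY : Y ⁻¹' {m'} = {ω | ∀ u, σ (u.2 :: List.ofFn u.1) ω = m' u} := by
          ext ω
          simp only [Set.mem_preimage, Set.mem_singleton_iff, funext_iff]
          rfl
        simp only [measureReal_def] at h ⊢
        rw [cond_apply hroot, cond_apply hroot, ← Set.inter_assoc, hY, ENNReal.toReal_mul,
          ENNReal.toReal_mul, h, mul_assoc])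
    simp_rw [levelCount_succ_eq_sum]
    simp_rw [levelCount_eq_sum] at ih
    refine step.trans ?_
    simp only [Fintype.card_fin, Fintype.card_pi, Finset.prod_const, Finset.card_univ]
    push_cast
    refine (add_le_add_left (mul_le_mul_of_nonneg_left ih (sq_nonneg _)) _).trans_eq ?_
    rw [Finset.sum_range_succ']
    simp only [pow_succ _ (_ : ℕ), ← Finset.sum_mul]
    ring

/-- For the broadcast process on the infinite rooted `d`-regular tree,
conditioned on the root label being `1`, assuming `λ²d > 1` and setting
`R = p(2 − p − p/(q−1))`, for every `k ≥ 1` and every `i ≠ 1`: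
`Var(Z_{ρ,k}) < R d^k ((λ²d)^k − 1)/(λ²d − 1)` and the same bound for `Y^{(i)}_{ρ,k}`. -/
theorem broadcast_levelCount_variance
    (q d : ℕ) (hq : 3 ≤ q) (hd : 1 ≤ d) (p : ℝ) (hp0 : 0 < p) (hp1 : p < 1)
    (Ω : Type) [MeasurableSpace Ω] (μ : Measure Ω) [IsProbabilityMeasure μ]
    (σ : List (Fin d) → Ω → Fin q) (hmeas : ∀ v, Measurable (σ v))
    (hlaw : ∀ (k : ℕ) (ℓ : List (Fin d) → Fin q),
      (μ {ω | ∀ v : List (Fin d), v.length ≤ k → σ v ω = ℓ v}).toReal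
        = ((q : ℝ))⁻¹ * ∏ j ∈ Finset.range k, ∏ f : Fin j → Fin d, ∏ i : Fin d,
            transM q p (ℓ (List.ofFn f)) (ℓ (i :: List.ofFn f)))
    (lam : ℝ) (hlam : lam = 1 - p * q / ((q : ℝ) - 1))
    (hKS : lam ^ 2 * d > 1)
    (R : ℝ) (hR : R = p * (2 - p - p / ((q : ℝ) - 1)))
    (k : ℕ) (hk : 1 ≤ k) (i : Fin q) (hi : i ≠ (⟨0, by omega⟩ : Fin q)) :
    (variance (fun ω => (levelCount q d σ (⟨0, by omega⟩ : Fin q) k ω : ℝ))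
        (μ[|{ω | σ [] ω = (⟨0, by omega⟩ : Fin q)}])
      < R * (d : ℝ) ^ k * ((lam ^ 2 * d) ^ k - 1) / (lam ^ 2 * d - 1)) ∧
    (variance (fun ω => (levelCount q d σ i k ω : ℝ))
        (μ[|{ω | σ [] ω = (⟨0, by omega⟩ : Fin q)}])
      < R * (d : ℝ) ^ k * ((lam ^ 2 * d) ^ k - 1) / (lam ^ 2 * d - 1)) := by
  have hd0 : (0 : ℝ) < d := by exact_mod_cast hd
  have main (b : Fin q) :
      variance (fun ω => (levelCount q d σ b k ω : ℝ))
        (μ[|{ω | σ [] ω = (⟨0, by omega⟩ : Fin q)}])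
      < R * (d : ℝ) ^ k * ((lam ^ 2 * d) ^ k - 1) / (lam ^ 2 * d - 1) := by
    obtain ⟨c₀, -, hc₀⟩ := Finset.exists_max_image Finset.univ
      (fun c => transM q p c b * (1 - transM q p c b)) ⟨b, Finset.mem_univ b⟩
    refine (variance_levelCount_le hq hmeas hlaw _ b (fun c => hc₀ c (Finset.mem_univ c)) k).trans_lt
      ?_
    rw [← hlam, mul_div_assoc, ← geom_sum_eq hKS.ne', hR]
    have hsum : 0 < ∑ j ∈ Finset.range k, (lam ^ 2 * d) ^ j :=
      Finset.sum_pos (fun j _ => pow_pos (by linarith) j) ⟨0, Finset.mem_range.mpr hk⟩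
    exact mul_lt_mul_of_pos_right (mul_lt_mul_of_pos_right
      (transM_mul_one_sub_lt hq hp0 hp1 c₀ b) (pow_pos hd0 k)) hsum
  exact ⟨main _, main i⟩
end

section
/- There exist constants C(q) and C'(q), depending only on q, such that for the broadcast process on the infinite rooted d-regular tree with q ≥ 3 communities: if λ²d > 4·C(q), then for every fixed d there exists k₀ = k₀(d, λ, q) so that for all k ≥ k₀, both E_k ≥ 1 − C'(q)·e^{−λ²d/50} and Ẽ_k ≥ 1 − C'(q)·e^{−λ²d/50}. -/
open MeasureTheory ProbabilityTheory Filter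

/-- The σ-algebra generated by the depth-`m` labels of the process `leaves`. -/
noncomputable def leafAlg {Ω : Type} [MeasurableSpace Ω] {q d : ℕ}
    (leaves : List (Fin d) → Ω → Fin q) (m : ℕ) : MeasurableSpace Ω :=
  MeasurableSpace.comap (fun ω => fun f : Fin m → Fin d => leaves (List.ofFn f) ω)
    inferInstance

/-- Posterior probability that the root label equals `i`, given the depth-`m` labels of
the process `leaves`. -/
noncomputable def posterior {Ω : Type} [MeasurableSpace Ω] {q d : ℕ} (μ : Measure Ω)
    (root : Ω → Fin q) (leaves : List (Fin d) → Ω → Fin q) (i : Fin q) (m : ℕ) : Ω → ℝ :=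
  μ[Set.indicator {ω | root ω = i} (fun _ => (1 : ℝ)) | leafAlg leaves m]

/-- Optimal probability of reconstructing the root from depth-`m` labels:
`E[max_i P(root = i | labels at depth m)]`. -/
noncomputable def optRecon {Ω : Type} [MeasurableSpace Ω] {q d : ℕ} (μ : Measure Ω)
    (root : Ω → Fin q) (leaves : List (Fin d) → Ω → Fin q) (m : ℕ) : ℝ :=
  ∫ ω, ⨆ i : Fin q, posterior μ root leaves i m ω ∂μ

section TreeChain

variable {Ω S : Type} {d : ℕ}

/-- A product over words of length `n + 1` splits into the tail and the first letter. -/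
theorem prod_words_succ (n : ℕ) (h : (Fin (n + 1) → Fin d) → ℝ) :
    ∏ f, h f = ∏ f : Fin n → Fin d, ∏ i : Fin d, h (Fin.cons i f) := by
  rw [← Equiv.prod_comp (Fin.consEquiv fun _ : Fin (n + 1) => Fin d) h, Fintype.prod_prod_type,
    Finset.prod_comm]
  rfl

/-- The event that the process `X` agrees with `x` up to depth `n`. -/
def agreeUpTo (X : List (Fin d) → Ω → S) (n : ℕ) (x : List (Fin d) → S) : Set Ω :=
  {ω | ∀ v, v.length ≤ n → X v ω = x v}

/-- Overwrite the labels of `x` at depth `n` by `z`. -/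
noncomputable def overwriteLevel (n : ℕ) (x : List (Fin d) → S) (z : (Fin n → Fin d) → S) :
    List (Fin d) → S :=
  Function.extend List.ofFn z x

theorem overwriteLevel_ofFn (n : ℕ) (x : List (Fin d) → S) (z : (Fin n → Fin d) → S)
    (f : Fin n → Fin d) : overwriteLevel n x z (List.ofFn f) = z f :=
  List.ofFn_injective.extend_apply z x f

theorem overwriteLevel_of_length_ne {n : ℕ} (x : List (Fin d) → S) (z : (Fin n → Fin d) → S)
    {v : List (Fin d)} (hv : v.length ≠ n) : overwriteLevel n x z v = x v :=
  Function.extend_apply' _ _ _ (by rintro ⟨f, rfl⟩; simp at hv)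

theorem agreeUpTo_eq_iUnion (X : List (Fin d) → Ω → S) (n : ℕ) (x : List (Fin d) → S) :
    agreeUpTo X n x = ⋃ z, agreeUpTo X (n + 1) (overwriteLevel (n + 1) x z) := by
  ext ω
  simp only [Set.mem_iUnion]
  constructor
  · intro h
    refine ⟨fun f => X (List.ofFn f) ω, fun v hv => ?_⟩
    rcases Nat.lt_or_eq_of_le hv with hlt | heq
    · rw [overwriteLevel_of_length_ne _ _ hlt.ne]
      exact h v (by omega)
    · obtain ⟨f, rfl⟩ : ∃ f : Fin (n + 1) → Fin d, List.ofFn f = v :=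
        ⟨fun i => v.get (Fin.cast heq.symm i), by
          exact List.ext_getElem (by simp [heq]) fun i _ _ => by rw [List.getElem_ofFn]; rfl⟩
      rw [overwriteLevel_ofFn]
  · rintro ⟨z, hz⟩ v hv
    rw [hz v (by omega), overwriteLevel_of_length_ne _ _ (by omega)]

theorem pairwise_disjoint_agreeUpTo_overwriteLevel (X : List (Fin d) → Ω → S) (n : ℕ)
    (x : List (Fin d) → S) :
    Pairwise (Function.onFun Disjoint fun z => agreeUpTo X n (overwriteLevel n x z)) := by
  intro z z' hne
  refine Set.disjoint_left.2 fun ω h h' => hne (funext fun f => ?_)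
  have hl : (List.ofFn f).length ≤ n := by simp
  rw [← overwriteLevel_ofFn n x z f, ← overwriteLevel_ofFn n x z' f, ← h _ hl, ← h' _ hl]

variable [MeasurableSpace Ω] {μ : Measure Ω}

/-- `X` is the tree-indexed Markov chain with initial weights `init` and transition kernel `K`. -/
def IsTreeChain (μ : Measure Ω) (X : List (Fin d) → Ω → S) (init : S → ℝ) (K : S → S → ℝ) :
    Prop :=
  ∀ n x, μ.real (agreeUpTo X n x) = init (x []) *
    ∏ j ∈ Finset.range n, ∏ f : Fin j → Fin d, ∏ i : Fin d,
      K (x (List.ofFn f)) (x (i :: List.ofFn f))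

theorem IsTreeChain.measureReal_overwriteLevel {X : List (Fin d) → Ω → S} {init : S → ℝ}
    {K : S → S → ℝ} (h : IsTreeChain μ X init K) (n : ℕ) (x : List (Fin d) → S)
    (z : (Fin (n + 1) → Fin d) → S) :
    μ.real (agreeUpTo X (n + 1) (overwriteLevel (n + 1) x z)) = μ.real (agreeUpTo X n x) *
      ∏ f : Fin n → Fin d, ∏ i : Fin d, K (x (List.ofFn f)) (z (Fin.cons i f)) := by
  rw [h, h, Finset.prod_range_succ, ← mul_assoc]
  congr 1
  · rw [overwriteLevel_of_length_ne _ _ (by simp)]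
    congr 1
    refine Finset.prod_congr rfl fun j hj => Finset.prod_congr rfl fun f _ =>
      Finset.prod_congr rfl fun i _ => ?_
    have hj := Finset.mem_range.1 hj
    rw [overwriteLevel_of_length_ne _ _ (by simp; omega),
      overwriteLevel_of_length_ne _ _ (by simp; omega)]
  · refine Finset.prod_congr rfl fun f _ => Finset.prod_congr rfl fun i _ => ?_
    rw [overwriteLevel_of_length_ne _ _ (by simp), ← List.ofFn_cons, overwriteLevel_ofFn]

variable [MeasurableSpace S] [MeasurableSingletonClass S]

theorem measurableSet_agreeUpTo {X : List (Fin d) → Ω → S} (hX : ∀ v, Measurable (X v))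
    (n : ℕ) (x : List (Fin d) → S) : MeasurableSet (agreeUpTo X n x) := by
  have : agreeUpTo X n x = ⋂ v : List (Fin d), ⋂ _ : v.length ≤ n, X v ⁻¹' {x v} := by
    ext ω; simp [agreeUpTo]
  rw [this]
  exact MeasurableSet.iInter fun v => MeasurableSet.iInter fun _ =>
    hX v (measurableSet_singleton _)

theorem setIntegral_agreeUpTo {X : List (Fin d) → Ω → S} (hX : ∀ v, Measurable (X v)) (n : ℕ)
    (x : List (Fin d) → S) (h : ((Fin n → Fin d) → S) → ℝ) :
    ∫ ω in agreeUpTo X n x, h (fun f => X (List.ofFn f) ω) ∂μ =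
      μ.real (agreeUpTo X n x) * h fun f => x (List.ofFn f) := by
  have : ∀ ω ∈ agreeUpTo X n x,
      h (fun f => X (List.ofFn f) ω) = h (fun f => x (List.ofFn f)) := fun ω hω => by
    congr 1; funext f; exact hω _ (by simp)
  rw [setIntegral_congr_fun (measurableSet_agreeUpTo hX n x) this, setIntegral_const, smul_eq_mul]

variable [Fintype S]

/-- One step of the recursion for multiplicative functionals of a tree-indexed chain. -/
def treeStep (d : ℕ) (K : S → S → ℝ) (F : S → ℝ) (x : S) : ℝ := (∑ y, K x y * F y) ^ d

theorem integrable_comp_level [IsFiniteMeasure μ] {X : List (Fin d) → Ω → S}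
    (hX : ∀ v, Measurable (X v)) (n : ℕ) (h : ((Fin n → Fin d) → S) → ℝ) :
    Integrable (fun ω => h fun f => X (List.ofFn f) ω) μ :=
  Integrable.comp_measurable (g := h) (f := fun ω f => X (List.ofFn f) ω) Integrable.of_finite
    (measurable_pi_lambda _ fun f => hX (List.ofFn f))

theorem IsTreeChain.setIntegral_agreeUpTo_prod [IsFiniteMeasure μ] {X : List (Fin d) → Ω → S}
    (hX : ∀ v, Measurable (X v)) {init : S → ℝ} {K : S → S → ℝ} (h : IsTreeChain μ X init K)
    (n : ℕ) (x : List (Fin d) → S) (F : S → ℝ) :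
    ∫ ω in agreeUpTo X n x, ∏ f : Fin (n + 1) → Fin d, F (X (List.ofFn f) ω) ∂μ =
      ∫ ω in agreeUpTo X n x, ∏ f : Fin n → Fin d, treeStep d K F (X (List.ofFn f) ω) ∂μ := by
  classical
  rw [setIntegral_agreeUpTo hX n x fun y => ∏ f, treeStep d K F (y f), agreeUpTo_eq_iUnion,
    integral_iUnion_fintype (fun z => measurableSet_agreeUpTo hX _ _)
      (pairwise_disjoint_agreeUpTo_overwriteLevel X (n + 1) x)
      (fun z => (integrable_comp_level hX (n + 1) fun y => ∏ f, F (y f)).integrableOn),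
    ← agreeUpTo_eq_iUnion]
  have hz : ∀ z : (Fin (n + 1) → Fin d) → S,
      ∫ ω in agreeUpTo X (n + 1) (overwriteLevel (n + 1) x z),
        ∏ f : Fin (n + 1) → Fin d, F (X (List.ofFn f) ω) ∂μ =
      μ.real (agreeUpTo X n x) * ∏ g : Fin (n + 1) → Fin d,
        K (x (List.ofFn (Fin.tail g))) (z g) * F (z g) := fun z => by
    rw [setIntegral_agreeUpTo hX (n + 1) _ fun y => ∏ f, F (y f),
      h.measureReal_overwriteLevel, mul_assoc, Finset.prod_mul_distrib]
    simp only [overwriteLevel_ofFn]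
    rw [prod_words_succ n fun g => K (x (List.ofFn (Fin.tail g))) (z g)]
    simp only [Fin.tail_cons]
  simp only [hz]
  rw [← Finset.mul_sum, ← Fintype.prod_sum fun (g : Fin (n + 1) → Fin d) (y : S) =>
    K (x (List.ofFn (Fin.tail g))) y * F y, prod_words_succ n]
  simp [treeStep]

theorem IsTreeChain.setIntegral_root_prod_succ [IsFiniteMeasure μ] {X : List (Fin d) → Ω → S}
    (hX : ∀ v, Measurable (X v)) {init : S → ℝ} {K : S → S → ℝ} (h : IsTreeChain μ X init K)
    (n : ℕ) (x₀ : S) (F : S → ℝ) :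
    ∫ ω in {ω | X [] ω = x₀}, ∏ f : Fin (n + 1) → Fin d, F (X (List.ofFn f) ω) ∂μ =
      ∫ ω in {ω | X [] ω = x₀}, ∏ f : Fin n → Fin d,
        treeStep d K F (X (List.ofFn f) ω) ∂μ := by
  classical
  have hfin : Finite {v : List (Fin d) // v.length ≤ n} := List.finite_length_le (Fin d) n
  let ι := {c : {v : List (Fin d) // v.length ≤ n} → S // c ⟨[], by simp⟩ = x₀}
  let e : ι → List (Fin d) → S := fun c v => if hv : v.length ≤ n then c.1 ⟨v, hv⟩ else x₀
  have he : ∀ (c : ι) v (hv : v.length ≤ n), e c v = c.1 ⟨v, hv⟩ := fun c v hv => dif_pos hv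
  have hU : {ω | X [] ω = x₀} = ⋃ c : ι, agreeUpTo X n (e c) := by
    ext ω
    simp only [Set.mem_ofPred_eq, Set.mem_iUnion]
    constructor
    · intro hω
      exact ⟨⟨fun v => X v ω, hω⟩, fun v hv => by rw [he _ v hv]⟩
    · rintro ⟨c, hc⟩
      rw [hc [] (by simp), he c [] (by simp), c.2]
  have hdisj : Pairwise (Function.onFun Disjoint fun c : ι => agreeUpTo X n (e c)) := by
    intro c c' hne
    refine Set.disjoint_left.2 fun ω hω hω' => hne (Subtype.ext (funext fun v => ?_))
    rw [← he c v.1 v.2, ← he c' v.1 v.2, ← hω _ v.2, ← hω' _ v.2]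
  rw [hU, integral_iUnion (fun c => measurableSet_agreeUpTo hX _ _) hdisj
      (integrable_comp_level hX (n + 1) fun y => ∏ f, F (y f)).integrableOn,
    integral_iUnion (fun c => measurableSet_agreeUpTo hX _ _) hdisj
      (integrable_comp_level hX n fun y => ∏ f, treeStep d K F (y f)).integrableOn]
  exact tsum_congr fun c => h.setIntegral_agreeUpTo_prod hX n (e c) F

/-- Multiplicative functionals of level `n` of a tree-indexed chain, restricted to the value of the
root, are given by iterating `treeStep`. -/
theorem IsTreeChain.setIntegral_root_prod [IsFiniteMeasure μ] {X : List (Fin d) → Ω → S}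
    (hX : ∀ v, Measurable (X v)) {init : S → ℝ} {K : S → S → ℝ} (h : IsTreeChain μ X init K)
    (n : ℕ) (x₀ : S) (F : S → ℝ) :
    ∫ ω in {ω | X [] ω = x₀}, ∏ f : Fin n → Fin d, F (X (List.ofFn f) ω) ∂μ =
      init x₀ * (treeStep d K)^[n] F x₀ := by
  induction n generalizing F with
  | succ n ih => rw [h.setIntegral_root_prod_succ hX, ih, Function.iterate_succ_apply]
  | zero =>
    have hA : {ω | X [] ω = x₀} = agreeUpTo X 0 fun _ => x₀ := by
      ext ω; simp [agreeUpTo]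
    rw [hA, setIntegral_agreeUpTo hX 0 _ fun y => ∏ f, F (y f), h]
    simp

end TreeChain

/-- **Hoeffding's lemma** for a finitely supported distribution on `[0, 1]`. -/
theorem sum_mul_exp_le_of_mem_Icc {ι : Type} [Fintype ι] (w x : ι → ℝ) (hw : ∀ i, 0 ≤ w i)
    (hw1 : ∑ i, w i = 1) {l : ℝ} (hx : ∀ i, x i ∈ Set.Icc l (l + 1)) (c : ℝ) :
    ∑ i, w i * Real.exp (c * x i) ≤ Real.exp (c * (∑ i, w i * x i) + c ^ 2 / 8) := by
  classical
  let _ : MeasurableSpace ι := ⊤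
  let ν : Measure ι := ∑ i, ENNReal.ofReal (w i) • Measure.dirac i
  have hint : ∀ f : ι → ℝ, ∫ i, f i ∂ν = ∑ i, w i * f i := fun f => by
    rw [integral_finsetSum_measure fun i _ =>
      (integrable_dirac (by simp)).smul_measure ENNReal.ofReal_ne_top]
    exact Finset.sum_congr rfl fun i _ => by
      rw [integral_smul_measure, integral_dirac, ENNReal.toReal_ofReal (hw i), smul_eq_mul]
  have : IsProbabilityMeasure ν := ⟨by
    simp [ν, ← ENNReal.ofReal_sum_of_nonneg fun i _ => hw i, hw1]⟩
  have h := (hasSubgaussianMGF_of_mem_Icc (μ := ν) (X := x) (measurable_of_finite x).aemeasurable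
    (Filter.Eventually.of_forall hx)).mgf_le c
  rw [mgf, hint, hint] at h
  have he : ∀ i, w i * Real.exp (c * x i) =
      Real.exp (c * ∑ i, w i * x i) * (w i * Real.exp (c * (x i - ∑ i, w i * x i))) := fun i => by
    rw [mul_left_comm, ← Real.exp_add]; congr 2; ring
  rw [Finset.sum_congr rfl fun i _ => he i, ← Finset.mul_sum, Real.exp_add]
  refine mul_le_mul_of_nonneg_left (h.trans_eq ?_) (Real.exp_pos _).le
  congr 1
  simp
  ring

/-- Any reconstruction rule based on level `m` is at most as successful as the optimal one. -/
theorem measureReal_reconstruct_le_optRecon {Ω : Type} [MeasurableSpace Ω] {q d : ℕ}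
    (μ : Measure Ω) [IsProbabilityMeasure μ] {root : Ω → Fin q} {leaves : List (Fin d) → Ω → Fin q}
    (hroot : Measurable root) (hleaves : ∀ v, Measurable (leaves v)) (m : ℕ)
    (e : ((Fin m → Fin d) → Fin q) → Fin q) :
    μ.real {ω | e (fun f => leaves (List.ofFn f) ω) = root ω} ≤ optRecon μ root leaves m := by
  classical
  set L : Ω → (Fin m → Fin d) → Fin q := fun ω f => leaves (List.ofFn f) ω with hL
  have hLm : Measurable L := measurable_pi_lambda _ fun f => hleaves _
  have hle : leafAlg leaves m ≤ ‹MeasurableSpace Ω› := hLm.comap_le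
  let A : Fin q → Set Ω := fun i => {ω | e (L ω) = i}
  have hA : ∀ i, MeasurableSet[leafAlg leaves m] (A i) := fun i =>
    ⟨{y | e y = i}, (Set.toFinite _).measurableSet, rfl⟩
  have hA' : ∀ i, MeasurableSet (A i) := fun i => hle _ (hA i)
  have hR : ∀ i, MeasurableSet {ω | root ω = i} := fun i => hroot (measurableSet_singleton i)
  have hpi : ∀ i, Integrable (posterior μ root leaves i m) μ := fun i => integrable_condExp
  have hsup : Integrable (fun ω => ⨆ i, posterior μ root leaves i m ω) μ := by
    refine (integrable_finsetSum Finset.univ fun i _ => (hpi i).norm).mono'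
      (AEMeasurable.iSup fun i => (hpi i).aemeasurable).aestronglyMeasurable
      (Filter.Eventually.of_forall fun ω => ?_)
    rcases isEmpty_or_nonempty (Fin q) with hq | hq
    · simp
    · obtain ⟨i, hi⟩ := exists_eq_ciSup_of_finite (f := fun i => posterior μ root leaves i m ω)
      rw [← hi]
      exact Finset.single_le_sum (f := fun i => ‖posterior μ root leaves i m ω‖)
        (fun _ _ => norm_nonneg _) (Finset.mem_univ i)
  have hset : {ω | e (L ω) = root ω} = ⋃ i, A i ∩ {ω | root ω = i} := by
    ext ω; simp [A, eq_comm]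
  calc μ.real {ω | e (L ω) = root ω}
      = ∑ i, μ.real (A i ∩ {ω | root ω = i}) := by
        rw [hset, measureReal_iUnion_fintype _ fun i => (hA' i).inter (hR i)]
        intro i j hij
        exact Set.disjoint_left.2 fun ω h h' => hij (h.2.symm.trans h'.2)
    _ = ∑ i, ∫ ω in A i, posterior μ root leaves i m ω ∂μ := by
        refine Finset.sum_congr rfl fun i _ => ?_
        rw [_root_.posterior, setIntegral_condExp hle ((integrable_const _).indicator (hR i)) (hA i),
          setIntegral_indicator (hR i)]
        simp
    _ = ∫ ω, ∑ i, (A i).indicator (posterior μ root leaves i m) ω ∂μ := by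
        rw [integral_finsetSum _ fun i _ => (hpi i).indicator (hA' i)]
        exact Finset.sum_congr rfl fun i _ => (integral_indicator (hA' i)).symm
    _ ≤ optRecon μ root leaves m := by
        refine integral_mono (integrable_finsetSum _ fun i _ => (hpi i).indicator (hA' i)) hsup
          fun ω => ?_
        have : ∑ i, (A i).indicator (posterior μ root leaves i m) ω =
            posterior μ root leaves (e (L ω)) m ω := by
          simp [Set.indicator_apply, A]
        simp only [this]
        exact le_ciSup (f := fun i => posterior μ root leaves i m ω)
          (Set.finite_range _).bddAbove _

section Broadcast

variable {q d : ℕ} {p lam : ℝ} {Δ : Fin q → Fin q → ℝ}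

theorem sum_transM_mul (hq : 2 ≤ q) (hlam : lam = 1 - p * q / ((q : ℝ) - 1)) (a : Fin q)
    (m : Fin q → ℝ) :
    ∑ b, transM q p a b * m b = lam * m a + (1 - lam) / q * ∑ b, m b := by
  have hq' : (2 : ℝ) ≤ q := by exact_mod_cast hq
  have h : ∀ b, transM q p a b * m b =
      p / ((q : ℝ) - 1) * m b + if a = b then (1 - p - p / ((q : ℝ) - 1)) * m b else 0 := by
    intro b
    unfold transM
    split_ifs <;> ring
  rw [Finset.sum_congr rfl fun b _ => h b, Finset.sum_add_distrib, Finset.sum_ite_eq,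
    ← Finset.mul_sum, if_pos (Finset.mem_univ a), hlam]
  have : (q : ℝ) - 1 ≠ 0 := by linarith
  field_simp
  ring

theorem transM_nonneg (hq : 1 ≤ q) (hp0 : 0 ≤ p) (hp1 : p ≤ 1) (a b : Fin q) :
    0 ≤ transM q p a b := by
  have hq' : (1 : ℝ) ≤ q := by exact_mod_cast hq
  unfold transM
  split_ifs
  · linarith
  · exact div_nonneg hp0 (by linarith)

/-- Transition kernel of the pair (label, noisy label). -/
noncomputable def noisyKernel (p : ℝ) (Δ : Fin q → Fin q → ℝ) (x y : Fin q × Fin q) : ℝ :=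
  transM q p x.1 y.1 * Δ y.1 y.2

/-- Root distribution of the pair (label, noisy label). -/
noncomputable def noisyInit (Δ : Fin q → Fin q → ℝ) (x : Fin q × Fin q) : ℝ :=
  (q : ℝ)⁻¹ * Δ x.1 x.2

/-- Average of a functional of the pair (label, noisy label) over the noise. -/
noncomputable def noiseAvg (Δ : Fin q → Fin q → ℝ) (F : Fin q × Fin q → ℝ) (i : Fin q) : ℝ :=
  ∑ t, Δ i t * F (i, t)

theorem treeStep_noisyKernel (F : Fin q × Fin q → ℝ) (x : Fin q × Fin q) :
    treeStep d (noisyKernel p Δ) F x = (∑ b, transM q p x.1 b * noiseAvg Δ F b) ^ d := by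
  simp only [treeStep, noisyKernel, noiseAvg, Fintype.sum_prod_type, Finset.mul_sum, mul_assoc]

theorem noiseAvg_treeStep (hrow : ∀ i, ∑ t, Δ i t = 1) (F : Fin q × Fin q → ℝ) (i : Fin q) :
    noiseAvg Δ (treeStep d (noisyKernel p Δ) F) i =
      (∑ b, transM q p i b * noiseAvg Δ F b) ^ d := by
  simp only [noiseAvg, treeStep_noisyKernel]
  rw [← Finset.sum_mul, hrow, one_mul]

theorem noiseAvg_nonneg (hΔ : ∀ i j, 0 ≤ Δ i j) {F : Fin q × Fin q → ℝ} (hF : ∀ x, 0 ≤ F x)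
    (i : Fin q) : 0 ≤ noiseAvg Δ F i :=
  Finset.sum_nonneg fun t _ => mul_nonneg (hΔ i t) (hF (i, t))

theorem noiseAvg_treeStep_le (hq : 2 ≤ q) (hp0 : 0 ≤ p) (hp1 : p ≤ 1)
    (hlam : lam = 1 - p * q / ((q : ℝ) - 1)) (hΔ : ∀ i j, 0 ≤ Δ i j)
    (hrow : ∀ i, ∑ t, Δ i t = 1) {F : Fin q × Fin q → ℝ} (hF : ∀ x, 0 ≤ F x) {m : Fin q → ℝ}
    (hm0 : ∑ i, m i = 0) {l : ℝ} (hm : ∀ i, m i ∈ Set.Icc l (l + 1)) {c v : ℝ}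
    (h : ∀ b, noiseAvg Δ F b ≤ Real.exp (c * m b + v)) (i : Fin q) :
    noiseAvg Δ (treeStep d (noisyKernel p Δ) F) i ≤
      Real.exp (d * lam * c * m i + d * (v + c ^ 2 / 8)) := by
  have hM := transM_nonneg (q := q) (by omega) hp0 hp1
  have hM1 : ∑ b, transM q p i b = 1 := by
    have := sum_transM_mul (p := p) hq hlam i fun _ => 1
    have hq' : (q : ℝ) ≠ 0 := by positivity
    simp only [mul_one, Finset.sum_const, Finset.card_univ, Fintype.card_fin, nsmul_eq_mul] at this
    rw [this]
    field_simp
    ring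
  rw [noiseAvg_treeStep hrow]
  calc (∑ b, transM q p i b * noiseAvg Δ F b) ^ d
      ≤ (Real.exp (c * (lam * m i) + c ^ 2 / 8 + v)) ^ d := by
        gcongr
        · exact Finset.sum_nonneg fun b _ => mul_nonneg (hM i b) (noiseAvg_nonneg hΔ hF b)
        · calc ∑ b, transM q p i b * noiseAvg Δ F b
              ≤ ∑ b, transM q p i b * Real.exp (c * m b) * Real.exp v :=
                Finset.sum_le_sum fun b _ => by
                  rw [mul_assoc, ← Real.exp_add]
                  exact mul_le_mul_of_nonneg_left (h b) (hM i b)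
            _ ≤ Real.exp (c * (lam * m i) + c ^ 2 / 8) * Real.exp v := by
                rw [← Finset.sum_mul]
                gcongr
                have := sum_mul_exp_le_of_mem_Icc (transM q p i) m (hM i) hM1 hm c
                rwa [sum_transM_mul hq hlam i m, hm0, mul_zero, add_zero] at this
            _ = _ := by rw [← Real.exp_add]
    _ = _ := by
        rw [← Real.exp_nat_mul]
        congr 1
        ring

theorem iterate_treeStep_nonneg (hq : 1 ≤ q) (hp0 : 0 ≤ p) (hp1 : p ≤ 1)
    (hΔ : ∀ i j, 0 ≤ Δ i j) {F : Fin q × Fin q → ℝ} (hF : ∀ x, 0 ≤ F x) (n : ℕ)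
    (x : Fin q × Fin q) : 0 ≤ (treeStep d (noisyKernel p Δ))^[n] F x := by
  induction n generalizing x with
  | zero => exact hF x
  | succ n ih =>
    rw [Function.iterate_succ_apply', treeStep_noisyKernel]
    exact pow_nonneg (Finset.sum_nonneg fun b _ =>
      mul_nonneg (transM_nonneg hq hp0 hp1 _ _) (noiseAvg_nonneg hΔ ih b)) d

/-- Uniformly in the depth, the linear statistic is sub-Gaussian given the root label. -/
theorem noiseAvg_iterate_le (hq : 2 ≤ q) (hp0 : 0 ≤ p) (hp1 : p ≤ 1)
    (hlam : lam = 1 - p * q / ((q : ℝ) - 1)) (hD : 2 ≤ lam ^ 2 * d) (hΔ : ∀ i j, 0 ≤ Δ i j)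
    (hrow : ∀ i, ∑ t, Δ i t = 1) {G : Fin q × Fin q → ℝ} {l : ℝ}
    (hG : ∀ x, G x ∈ Set.Icc l (l + 1)) (hG0 : ∑ i, noiseAvg Δ G i = 0) (c : ℝ) (n : ℕ)
    (i : Fin q) :
    noiseAvg Δ ((treeStep d (noisyKernel p Δ))^[n + 1] fun x => Real.exp (c * G x)) i ≤
      Real.exp (c * (d * lam) ^ (n + 1) * noiseAvg Δ G i +
        (c * (d * lam) ^ (n + 1)) ^ 2 / (4 * (lam ^ 2 * d))) := by
  have hm : ∀ i, noiseAvg Δ G i ∈ Set.Icc l (l + 1) := fun i =>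
    (convex_Icc l (l + 1)).sum_mem (fun t _ => hΔ i t) (hrow i) fun t _ => hG (i, t)
  have hnn := iterate_treeStep_nonneg (q := q) (d := d) (Δ := Δ) (by omega) hp0 hp1 hΔ
    (F := fun x => Real.exp (c * G x)) fun x => (Real.exp_pos _).le
  have hstep : ∀ n, (∀ i, noiseAvg Δ ((treeStep d (noisyKernel p Δ))^[n]
        fun x => Real.exp (c * G x)) i ≤ Real.exp (c * (d * lam) ^ n * noiseAvg Δ G i +
          (c * (d * lam) ^ n) ^ 2 / 8)) →
      ∀ i, noiseAvg Δ ((treeStep d (noisyKernel p Δ))^[n + 1] fun x => Real.exp (c * G x)) i ≤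
        Real.exp (c * (d * lam) ^ (n + 1) * noiseAvg Δ G i +
          (c * (d * lam) ^ (n + 1)) ^ 2 / (4 * (lam ^ 2 * d))) := by
    intro n h i
    rw [Function.iterate_succ_apply']
    refine (noiseAvg_treeStep_le hq hp0 hp1 hlam hΔ hrow (hnn n) hG0 hm h i).trans_eq ?_
    have hlam0 : lam ≠ 0 := by rintro rfl; norm_num at hD
    have hd0 : (d : ℝ) ≠ 0 := by intro h0; rw [h0] at hD; norm_num at hD
    congr 1
    field_simp
    ring
  refine hstep n (fun j => ?_) i
  clear i
  induction n generalizing j with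
  | zero =>
    simpa [noiseAvg] using
      sum_mul_exp_le_of_mem_Icc (Δ j) (fun t => G (j, t)) (hΔ j) (hrow j) (fun t => hG (j, t)) c
  | succ n ih =>
    refine (hstep n ih j).trans (Real.exp_le_exp.2 ?_)
    gcongr
    linarith

variable {Ω : Type} [MeasurableSpace Ω] {μ : Measure Ω}

theorem isTreeChain_noisy {σ τ : List (Fin d) → Ω → Fin q}
    (h : ∀ (k : ℕ) (ℓ t : List (Fin d) → Fin q),
      (μ {ω | ∀ v : List (Fin d), v.length ≤ k → σ v ω = ℓ v ∧ τ v ω = t v}).toReal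
        = ((q : ℝ))⁻¹ *
          (∏ j ∈ Finset.range k, ∏ f : Fin j → Fin d, ∏ i : Fin d,
            transM q p (ℓ (List.ofFn f)) (ℓ (i :: List.ofFn f))) *
          ∏ j ∈ Finset.range (k + 1), ∏ f : Fin j → Fin d,
            Δ (ℓ (List.ofFn f)) (t (List.ofFn f))) :
    IsTreeChain μ (fun v ω => (σ v ω, τ v ω)) (noisyInit Δ) (noisyKernel p Δ) := by
  intro k x
  have := h k (fun v => (x v).1) fun v => (x v).2
  rw [Finset.prod_range_succ'] at this
  simp only [agreeUpTo, Prod.ext_iff, measureReal_def]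
  rw [this]
  simp only [prod_words_succ, List.ofFn_cons, noisyKernel, Finset.prod_mul_distrib, noisyInit]
  simp
  ring

variable [IsProbabilityMeasure μ] {X : List (Fin d) → Ω → Fin q × Fin q}

theorem IsTreeChain.sum_noise_eq_one (hq : 2 ≤ q) (hd : 1 ≤ d) (hp0 : 0 ≤ p) (hp1 : p ≤ 1)
    (hlam : lam = 1 - p * q / ((q : ℝ) - 1)) (hlam0 : lam ≠ 0) (hΔ : ∀ i j, 0 ≤ Δ i j)
    (hcol : ∀ j, ∑ i, Δ i j = 1) (hdiag : ∀ i, 0 < Δ i i) (hX : ∀ v, Measurable (X v))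
    (h : IsTreeChain μ X (noisyInit Δ) (noisyKernel p Δ)) (i : Fin q) : ∑ t, Δ i t = 1 := by
  have hq0 : (0 : ℝ) < q := by positivity
  have h0 := h.setIntegral_root_prod hX 0 (i, i) fun _ => 1
  have h1 := h.setIntegral_root_prod hX 1 (i, i) fun _ => 1
  simp only [Finset.prod_const_one, Function.iterate_zero, id, Function.iterate_one,
    treeStep_noisyKernel] at h0 h1
  rw [h0] at h1
  have hinit : noisyInit Δ (i, i) ≠ 0 := (mul_pos (inv_pos.2 hq0) (hdiag i)).ne'
  have h2 := (mul_left_cancel₀ hinit h1).symm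
  have h3 := (pow_eq_one_iff_of_nonneg (Finset.sum_nonneg fun b _ =>
    mul_nonneg (transM_nonneg (by omega) hp0 hp1 _ _)
      (noiseAvg_nonneg hΔ (fun _ => zero_le_one) b)) (by omega : d ≠ 0)).1 h2
  have hsum : ∑ b, noiseAvg Δ (fun _ => 1) b = q := by
    simp only [noiseAvg, mul_one]
    rw [Finset.sum_comm]
    simp [hcol]
  rw [sum_transM_mul hq hlam, hsum, div_mul_cancel₀ _ hq0.ne'] at h3
  have h4 : lam * noiseAvg Δ (fun _ => 1) i = lam * 1 := by linarith
  simpa [noiseAvg] using mul_left_cancel₀ hlam0 h4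

/-- Chernoff bound for the normalized linear statistic of level `n + 1`. -/
theorem IsTreeChain.measureReal_linear_statistic_le (hq : 2 ≤ q) (hp0 : 0 ≤ p) (hp1 : p ≤ 1)
    (hlam : lam = 1 - p * q / ((q : ℝ) - 1)) (hD : 2 ≤ lam ^ 2 * d) (hΔ : ∀ i j, 0 ≤ Δ i j)
    (hrow : ∀ i, ∑ t, Δ i t = 1) (hX : ∀ v, Measurable (X v))
    (h : IsTreeChain μ X (noisyInit Δ) (noisyKernel p Δ)) {G : Fin q × Fin q → ℝ} {l : ℝ}
    (hG : ∀ x, G x ∈ Set.Icc l (l + 1)) (hG0 : ∑ i, noiseAvg Δ G i = 0) (n : ℕ) (i : Fin q)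
    (s r : ℝ) :
    μ.real ({ω | (X [] ω).1 = i} ∩
      {ω | r ≤ s * ((∑ f : Fin (n + 1) → Fin d, G (X (List.ofFn f) ω)) /
        (d * lam) ^ (n + 1))}) ≤
      (q : ℝ)⁻¹ * Real.exp (s * noiseAvg Δ G i + s ^ 2 / (4 * (lam ^ 2 * d)) - r) := by
  have hlam0 : lam ≠ 0 := by rintro rfl; norm_num at hD
  have hd0 : (d : ℝ) ≠ 0 := by intro h0; rw [h0] at hD; norm_num at hD
  have hpow : ((d : ℝ) * lam) ^ (n + 1) ≠ 0 := pow_ne_zero _ (mul_ne_zero hd0 hlam0)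
  set c := s / (d * lam) ^ (n + 1) with hc
  have hcs : c * (d * lam) ^ (n + 1) = s := div_mul_cancel₀ _ hpow
  have hR : {ω | (X [] ω).1 = i} = ⋃ t, {ω | X [] ω = (i, t)} := by
    ext ω; simp [Prod.ext_iff]
  have hRm : MeasurableSet {ω | (X [] ω).1 = i} :=
    (measurable_fst.comp (hX [])) (measurableSet_singleton i)
  let H : ((Fin (n + 1) → Fin d) → Fin q × Fin q) → ℝ := fun y => ∏ f, Real.exp (c * G (y f))
  have hH : Integrable (fun ω => H fun f => X (List.ofFn f) ω) μ :=
    integrable_comp_level hX (n + 1) H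
  have hHs : ∀ ω, H (fun f => X (List.ofFn f) ω) =
      Real.exp (s * ((∑ f : Fin (n + 1) → Fin d, G (X (List.ofFn f) ω)) /
        (d * lam) ^ (n + 1))) := fun ω => by
    simp only [H]
    rw [← Real.exp_sum, ← Finset.mul_sum, hc]
    congr 1
    ring
  have hint : ∫ ω in {ω | (X [] ω).1 = i}, H (fun f => X (List.ofFn f) ω) ∂μ ≤
      (q : ℝ)⁻¹ * Real.exp (s * noiseAvg Δ G i + s ^ 2 / (4 * (lam ^ 2 * d))) := by
    rw [hR, integral_iUnion_fintype (s := fun t => {ω | X [] ω = (i, t)}) (fun t => hX [] (measurableSet_singleton (i, t)))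
      (fun t t' hne => Set.disjoint_left.2 fun ω hω hω' =>
        hne (Prod.ext_iff.1 (hω.symm.trans hω')).2) (fun _ => hH.integrableOn),
      Finset.sum_congr rfl fun t _ =>
        h.setIntegral_root_prod hX (n + 1) (i, t) fun x => Real.exp (c * G x)]
    simp only [noisyInit, mul_assoc]
    rw [← Finset.mul_sum]
    have := noiseAvg_iterate_le hq hp0 hp1 hlam hD hΔ hrow hG hG0 c n i
    rw [hcs] at this
    exact mul_le_mul_of_nonneg_left this (by positivity)
  have hmarkov := mul_meas_ge_le_integral_of_nonneg
    (μ := μ.restrict {ω | (X [] ω).1 = i})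
    (Filter.Eventually.of_forall fun ω => (by simp only [hHs]; exact (Real.exp_pos _).le :
      0 ≤ H (fun f => X (List.ofFn f) ω))) hH.integrableOn (Real.exp r)
  rw [measureReal_restrict_apply' hRm] at hmarkov
  simp only [hHs, Real.exp_le_exp] at hmarkov hint
  rw [Real.exp_sub, ← mul_div_assoc, le_div_iff₀ (Real.exp_pos r), mul_comm, Set.inter_comm]
  exact hmarkov.trans hint

/-- Thresholding the linear statistics recovers the root label from the observations `Y (X v)` at
every positive depth, provided that an observation has bias at least `1 - 1 / q`. -/
theorem IsTreeChain.le_optRecon (hq : 3 ≤ q) (hp0 : 0 ≤ p) (hp1 : p ≤ 1)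
    (hlam : lam = 1 - p * q / ((q : ℝ) - 1)) (hD : 2 ≤ lam ^ 2 * d) (hΔ : ∀ i j, 0 ≤ Δ i j)
    (hrow : ∀ i, ∑ t, Δ i t = 1) (hX : ∀ v, Measurable (X v))
    (h : IsTreeChain μ X (noisyInit Δ) (noisyKernel p Δ)) (Y : Fin q × Fin q → Fin q)
    (hYcol : ∀ a, ∑ i, noiseAvg Δ (fun x => if Y x = a then 1 else 0) i = 1)
    (hYdiag : ∀ a, 1 - 1 / (q : ℝ) ≤ noiseAvg Δ (fun x => if Y x = a then 1 else 0) a) (n : ℕ) :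
    1 - q * Real.exp (-(lam ^ 2 * d) / 36) ≤
      optRecon μ (fun ω => (X [] ω).1) (fun v ω => Y (X v ω)) (n + 1) := by
  classical
  have hq' : (3 : ℝ) ≤ q := by exact_mod_cast hq
  have hq0 : (q : ℝ) ≠ 0 := by positivity
  have hqinv : 1 / (q : ℝ) ≤ 1 / 3 := one_div_le_one_div_of_le (by norm_num) hq'
  set D := lam ^ 2 * d with hDdef
  set θ : ℝ := 1 / 2 - 1 / q with hθ
  have hθ6 : 1 / 6 ≤ θ := by linarith
  let G : Fin q → Fin q → ℝ := fun a y => (if y = a then 1 else 0) - 1 / (q : ℝ)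
  let Z : Fin q → ((Fin (n + 1) → Fin d) → Fin q) → ℝ := fun a y =>
    (∑ f, G a (y f)) / (d * lam) ^ (n + 1)
  have hGmem : ∀ a (x : Fin q × Fin q), G a (Y x) ∈ Set.Icc (-(1 / (q : ℝ))) (-(1 / q) + 1) :=
    fun a x => by
      simp only [G]
      split_ifs <;> constructor <;> linarith
  have hGavg : ∀ a i, noiseAvg Δ (fun x => G a (Y x)) i =
      noiseAvg Δ (fun x => if Y x = a then 1 else 0) i - 1 / q := fun a i => by
    simp only [noiseAvg, G, mul_sub, Finset.sum_sub_distrib]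
    rw [← Finset.sum_mul, hrow, one_mul]
  have hG0 : ∀ a, ∑ i, noiseAvg Δ (fun x => G a (Y x)) i = 0 := fun a => by
    simp only [hGavg, Finset.sum_sub_distrib, hYcol]
    simp [hq0]
  have hoff : ∀ a i, i ≠ a → noiseAvg Δ (fun x => G a (Y x)) i ≤ 0 := fun a i hia => by
    have hle := Finset.add_le_sum (s := Finset.univ)
      (f := noiseAvg Δ fun x => if Y x = a then 1 else 0)
      (fun j _ => noiseAvg_nonneg hΔ (fun x => by split_ifs <;> norm_num) j)
      (Finset.mem_univ i) (Finset.mem_univ a) hia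
    have hd := hYdiag a
    rw [hYcol] at hle
    rw [hGavg]
    linarith
  have htail := fun a => h.measureReal_linear_statistic_le (by omega) hp0 hp1 hlam hD hΔ hrow hX
    (hGmem a) (hG0 a) n
  let obs : Ω → (Fin (n + 1) → Fin d) → Fin q := fun ω f => Y (X (List.ofFn f) ω)
  let E : Fin q × Fin q → Set Ω := fun ia => {ω | (X [] ω).1 = ia.1} ∩
    {ω | if ia.1 = ia.2 then Z ia.2 (obs ω) < θ else θ ≤ Z ia.2 (obs ω)}
  have hE : ∀ ia, μ.real (E ia) ≤ (q : ℝ)⁻¹ * Real.exp (-D / 36) := by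
    have hfin : ∀ x : ℝ, x ≤ -D * θ ^ 2 → (q : ℝ)⁻¹ * Real.exp x ≤
        (q : ℝ)⁻¹ * Real.exp (-D / 36) := fun x hx => by
      gcongr
      have : (1 / 6) ^ 2 ≤ θ ^ 2 := by gcongr
      nlinarith
    have hsq : (2 * D * θ) ^ 2 / (4 * D) = D * θ ^ 2 := by
      have : D ≠ 0 := by positivity
      field_simp
      norm_num
    rintro ⟨i, a⟩
    by_cases hia : i = a
    · subst hia
      refine (measureReal_mono (Set.inter_subset_inter_right _ fun ω hω => ?_)).trans
        ((htail i i (-(2 * D * θ)) (-(2 * D * θ) * θ)).trans (hfin _ ?_))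
      · have hω : Z i (obs ω) < θ := by simpa using hω
        exact mul_le_mul_of_nonpos_left hω.le (by nlinarith)
      · have h1 := hGavg i i
        have h2 := hYdiag i
        have h3 : 2 * θ ≤ noiseAvg Δ (fun x => G i (Y x)) i := by rw [h1, hθ]; linarith
        rw [neg_sq, hsq]
        have h4 : 0 ≤ 2 * D * θ := by positivity
        nlinarith [mul_le_mul_of_nonneg_left h3 h4]
    · refine (measureReal_mono (Set.inter_subset_inter_right _ fun ω hω => ?_)).trans
        ((htail a i (2 * D * θ) (2 * D * θ * θ)).trans (hfin _ ?_))
      · have hω : θ ≤ Z a (obs ω) := by simpa [hia] using hω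
        exact mul_le_mul_of_nonneg_left hω (by positivity)
      · rw [hsq]
        have h4 : 0 ≤ 2 * D * θ := by positivity
        nlinarith [mul_le_mul_of_nonneg_left (hoff a i hia) h4]
  let e : ((Fin (n + 1) → Fin d) → Fin q) → Fin q := fun y =>
    if hy : ∃ a, θ ≤ Z a y then hy.choose else ⟨0, by omega⟩
  have hroot : Measurable fun ω => (X [] ω).1 := measurable_fst.comp (hX [])
  have hobs : ∀ v, Measurable fun ω => Y (X v ω) := fun v =>
    (measurable_of_finite Y).comp (hX v)
  have hgood : MeasurableSet {ω | e (obs ω) = (X [] ω).1} :=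
    measurableSet_eq_fun
      ((measurable_of_finite e).comp (measurable_pi_lambda _ fun f => hobs (List.ofFn f))) hroot
  have hbad : {ω | e (obs ω) = (X [] ω).1}ᶜ ⊆ ⋃ ia, E ia := by
    intro ω hω
    by_contra hcon
    simp only [Set.mem_iUnion, not_exists] at hcon
    refine hω ?_
    have hcon' : ∀ a, (if (X [] ω).1 = a then θ ≤ Z a (obs ω) else Z a (obs ω) < θ) := fun a => by
      have := fun h => hcon ((X [] ω).1, a) ⟨rfl, h⟩
      by_cases ha : (X [] ω).1 = a <;> simpa [ha] using this
    have hex : ∃ a, θ ≤ Z a (obs ω) := ⟨_, by simpa using hcon' (X [] ω).1⟩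
    change (if hy : ∃ a, θ ≤ Z a (obs ω) then hy.choose else _) = _
    rw [dif_pos hex]
    by_contra hne
    have := hcon' hex.choose
    rw [if_neg (Ne.symm hne)] at this
    exact absurd hex.choose_spec (not_le.2 this)
  have hbadle : μ.real {ω | e (obs ω) = (X [] ω).1}ᶜ ≤ q * Real.exp (-D / 36) :=
    calc _ ≤ μ.real (⋃ ia, E ia) := measureReal_mono hbad
      _ ≤ ∑ ia, μ.real (E ia) := measureReal_iUnion_fintype_le _
      _ ≤ ∑ _ia : Fin q × Fin q, (q : ℝ)⁻¹ * Real.exp (-D / 36) :=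
        Finset.sum_le_sum fun ia _ => hE ia
      _ = q * Real.exp (-D / 36) := by
        simp
        field_simp
  rw [probReal_compl_eq_one_sub hgood] at hbadle
  have := measureReal_reconstruct_le_optRecon μ hroot hobs (n + 1) e
  linarith

end Broadcast

/-- There exist constants `C(q)`, `C'(q)` depending only on `q` such that
for the broadcast process on the rooted `d`-regular tree with `q ≥ 3` communities and noisy
labels `τ`: if `λ²d > 4C(q)` then there is `k₀` with
`E_k ≥ 1 − C'(q)e^{−λ²d/50}` and `Ẽ_k ≥ 1 − C'(q)e^{−λ²d/50}` for all `k ≥ k₀`. -/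
theorem broadcast_optRecon_lower_bound (q : ℕ) (hq : 3 ≤ q) :
    ∃ C C' : ℝ, 0 < C ∧ 0 < C' ∧
      ∀ (d : ℕ), 1 ≤ d →
      ∀ (p : ℝ), 0 < p → p < 1 →
      ∀ (Ω : Type) [MeasurableSpace Ω] (μ : Measure Ω) [IsProbabilityMeasure μ]
        (σ τ : List (Fin d) → Ω → Fin q),
        (∀ v, Measurable (σ v)) → (∀ v, Measurable (τ v)) →
      ∀ (Δ : Fin q → Fin q → ℝ),
        (∀ i j, 0 ≤ Δ i j ∧ Δ i j ≤ 1) →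
        (∀ j, ∑ i : Fin q, Δ i j = 1) →
        (∀ i, 1 - 1 / (q : ℝ) ≤ Δ i i) →
        (∀ (k : ℕ) (ℓ t : List (Fin d) → Fin q),
          (μ {ω | ∀ v : List (Fin d), v.length ≤ k → σ v ω = ℓ v ∧ τ v ω = t v}).toReal
            = ((q : ℝ))⁻¹ *
              (∏ j ∈ Finset.range k, ∏ f : Fin j → Fin d, ∏ i : Fin d,
                transM q p (ℓ (List.ofFn f)) (ℓ (i :: List.ofFn f))) *
              ∏ j ∈ Finset.range (k + 1), ∏ f : Fin j → Fin d,
                Δ (ℓ (List.ofFn f)) (t (List.ofFn f))) →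
      ∀ (lam : ℝ), lam = 1 - p * q / ((q : ℝ) - 1) →
        lam ^ 2 * d > 4 * C →
        ∃ k₀ : ℕ, ∀ k : ℕ, k₀ ≤ k →
          optRecon μ (σ []) σ k ≥ 1 - C' * Real.exp (-(lam ^ 2 * d) / 50) ∧
          optRecon μ (σ []) τ k ≥ 1 - C' * Real.exp (-(lam ^ 2 * d) / 50) := by
  refine ⟨1, q, one_pos, by positivity, ?_⟩
  intro d hd p hp0 hp1 Ω _ μ _ σ τ hσ hτ Δ hΔ01 hcol hdiag hlaw lam hlam hlamd
  have hΔ : ∀ i j, 0 ≤ Δ i j := fun i j => (hΔ01 i j).1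
  have hq' : (3 : ℝ) ≤ q := by exact_mod_cast hq
  have hqinv : 1 / (q : ℝ) ≤ 1 / 3 := one_div_le_one_div_of_le (by norm_num) hq'
  have hqinv0 : 0 ≤ 1 / (q : ℝ) := by positivity
  have hD : 2 ≤ lam ^ 2 * d := by linarith
  have hlam0 : lam ≠ 0 := by rintro rfl; norm_num at hD
  have hX : ∀ v, Measurable fun ω => (σ v ω, τ v ω) := fun v => (hσ v).prodMk (hτ v)
  have hchain := isTreeChain_noisy hlaw
  have hrow := hchain.sum_noise_eq_one (by omega) hd hp0.le hp1.le hlam hlam0 hΔ hcol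
    (fun i => by linarith [hdiag i]) hX
  have hfst : ∀ a i, noiseAvg Δ (fun x => if x.1 = a then 1 else 0) i =
      if i = a then 1 else 0 := fun a i => by
    by_cases hia : i = a <;> simp [noiseAvg, hia, hrow]
  have hsnd : ∀ a i, noiseAvg Δ (fun x => if x.2 = a then 1 else 0) i = Δ i a := fun a i => by
    simp [noiseAvg]
  have hbound := hchain.le_optRecon hq hp0.le hp1.le hlam hD hΔ hrow hX
  have hexp : (q : ℝ) * Real.exp (-(lam ^ 2 * d) / 36) ≤
      q * Real.exp (-(lam ^ 2 * d) / 50) :=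
    mul_le_mul_of_nonneg_left (Real.exp_le_exp.2 (by linarith)) (by positivity)
  refine ⟨1, fun k hk => ?_⟩
  obtain ⟨n, rfl⟩ := Nat.exists_eq_add_of_le' hk
  constructor
  · have := hbound Prod.fst (fun a => by simp [hfst]) (fun a => by simp [hfst]) n
    exact (sub_le_sub_left hexp 1).trans this
  · have := hbound Prod.snd (fun a => by simp [hsnd, hcol]) (fun a => by
      rw [hsnd]; exact hdiag a) n
    exact (sub_le_sub_left hexp 1).trans this
end

section
/- Fix ξ > 0. For the broadcast process on the infinite rooted d-regular tree with q ≥ 3 communities, if λ ≤ 1−ξ and λ²d > C*(q, ξ)·log d (with C*(q, ξ) the constant from the contraction proposition), then lim_{m→∞} |E_m − Ẽ_m| = 0, i.e. the optimal probabilities of reconstructing the root label from the exact labels and from the noisy labels at depth m have the same limit. -/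
open MeasureTheory ProbabilityTheory Filter

/-- The Bhattacharyya coefficient of two vectors. -/
noncomputable def bhatt {α : Type*} [Fintype α] (P Q : α → ℝ) : ℝ := ∑ a, √(P a * Q a)

/-- The mixture of the rows of `P` with weights the rows of `M`. -/
def mixRows {ι α : Type*} [Fintype ι] (M : ι → ι → ℝ) (P : ι → α → ℝ) (i : ι) (a : α) : ℝ :=
  ∑ c, M i c * P c a

/-- The pointwise defect of the concavity of the geometric mean, for the pair `(x, x')`
relative to its reference value `(y, y')`. -/
noncomputable def geomDefect (y y' x x' : ℝ) : ℝ := √(y * y') * (√(x / y) - √(x' / y')) ^ 2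

theorem geomDefect_nonneg (y y' x x' : ℝ) : 0 ≤ geomDefect y y' x x' := by
  unfold geomDefect; positivity

theorem geomDefect_eq {y y' x x' : ℝ} (hy : 0 < y) (hy' : 0 < y') (hx : 0 ≤ x) (hx' : 0 ≤ x') :
    geomDefect y y' x x' = √y' / √y * x + √y / √y' * x' - 2 * √(x * x') := by
  unfold geomDefect
  rw [Real.sqrt_mul hy.le, Real.sqrt_mul hx, Real.sqrt_div hx, Real.sqrt_div hx']
  have h1 : 0 < √y := Real.sqrt_pos.2 hy
  have h2 : 0 < √y' := Real.sqrt_pos.2 hy'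
  field_simp
  linear_combination √y' ^ 2 * Real.sq_sqrt hx + √y ^ 2 * Real.sq_sqrt hx'

theorem two_mul_bhatt_sub_bhatt {α β : Type*} [Fintype α] [Fintype β]
    {P P' : α → ℝ} {Q Q' : β → ℝ} {K : α → β → ℝ}
    (hP : ∀ a, 0 ≤ P a) (hP' : ∀ a, 0 ≤ P' a) (hQ : ∀ b, 0 < Q b) (hQ' : ∀ b, 0 < Q' b)
    (hK : ∀ a, ∑ b, K a b = 1) (hPQ : ∀ b, Q b = ∑ a, P a * K a b)
    (hPQ' : ∀ b, Q' b = ∑ a, P' a * K a b) :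
    2 * (bhatt Q Q' - bhatt P P') =
      ∑ a, ∑ b, K a b * geomDefect (Q b) (Q' b) (P a) (P' a) := by
  have h1 : ∀ a b, K a b * geomDefect (Q b) (Q' b) (P a) (P' a) =
      √(Q' b) / √(Q b) * (P a * K a b) + √(Q b) / √(Q' b) * (P' a * K a b)
        - 2 * √(P a * P' a) * K a b := by
    intro a b
    rw [geomDefect_eq (hQ b) (hQ' b) (hP a) (hP' a)]; ring
  simp only [h1, Finset.sum_sub_distrib, Finset.sum_add_distrib]
  rw [Finset.sum_comm (f := fun a b => √(Q' b) / √(Q b) * (P a * K a b)),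
    Finset.sum_comm (f := fun a b => √(Q b) / √(Q' b) * (P' a * K a b))]
  simp only [← Finset.mul_sum, ← hPQ, ← hPQ', hK, mul_one]
  have h2 : ∀ b, √(Q' b) / √(Q b) * Q b = √(Q b * Q' b) := by
    intro b
    have := Real.sqrt_pos.2 (hQ b)
    rw [Real.sqrt_mul (hQ b).le]
    nth_rewrite 2 [← Real.sq_sqrt (hQ b).le]
    field_simp
  have h3 : ∀ b, √(Q b) / √(Q' b) * Q' b = √(Q b * Q' b) := by
    intro b
    have := Real.sqrt_pos.2 (hQ' b)
    rw [Real.sqrt_mul (hQ b).le]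
    nth_rewrite 2 [← Real.sq_sqrt (hQ' b).le]
    field_simp
  simp only [h2, h3, bhatt, Finset.mul_sum, mul_sub]
  simp only [← Finset.mul_sum]
  ring

theorem geomDefect_mix_le {ι : Type*} [Fintype ι] {u v x y : ι → ℝ}
    (hu0 : ∀ c, 0 ≤ u c) (hu1 : ∀ c, u c ≤ 1) (hv0 : ∀ c, 0 ≤ v c) (hv1 : ∀ c, v c ≤ 1)
    (hx : ∀ c, 0 ≤ x c) (hy : ∀ c, 0 < y c) (hU : 0 < ∑ c, u c * y c)
    (hV : 0 < ∑ c, v c * y c) :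
    geomDefect (∑ c, u c * y c) (∑ c, v c * y c) (∑ c, u c * x c) (∑ c, v c * x c) ≤
      ∑ c, ∑ c', geomDefect (y c) (y c') (x c) (x c') := by
  set U := ∑ c, u c * y c with hUdef
  set V := ∑ c, v c * y c with hVdef
  set r : ι → ℝ := fun c => √(x c / y c) with hr
  have hr0 : ∀ c, 0 ≤ r c := fun c => Real.sqrt_nonneg _
  have hr2 : ∀ c, r c ^ 2 = x c / y c := fun c =>
    Real.sq_sqrt (div_nonneg (hx c) (hy c).le)
  -- the mean of `r` is at most its quadratic mean
  have key : ∀ w : ι → ℝ, (∀ c, 0 ≤ w c) → 0 < ∑ c, w c * y c →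
      ∑ c, w c * y c * r c ≤ (∑ c, w c * y c) * √((∑ c, w c * x c) / ∑ c, w c * y c) := by
    intro w hw hW
    have hcs := Finset.sum_mul_sq_le_sq_mul_sq Finset.univ (fun c => √(w c * y c))
      (fun c => √(w c * y c) * r c)
    have e1 : ∀ c, √(w c * y c) * (√(w c * y c) * r c) = w c * y c * r c := fun c => by
      rw [← mul_assoc, Real.mul_self_sqrt (mul_nonneg (hw c) (hy c).le)]
    have e2 : ∀ c, √(w c * y c) ^ 2 = w c * y c := fun c =>
      Real.sq_sqrt (mul_nonneg (hw c) (hy c).le)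
    have e3 : ∀ c, (√(w c * y c) * r c) ^ 2 = w c * x c := fun c => by
      rw [mul_pow, e2, hr2]; field_simp [(hy c).ne']
    simp only [e1, e2, e3] at hcs
    refine (Real.le_sqrt_of_sq_le hcs).trans (le_of_eq ?_)
    have hX : 0 ≤ ∑ c, w c * x c := Finset.sum_nonneg fun c _ => mul_nonneg (hw c) (hx c)
    rw [Real.sqrt_mul hW.le, Real.sqrt_div hX]
    have := Real.sqrt_pos.2 hW
    field_simp
    rw [Real.sq_sqrt hW.le, mul_comm]
  have hA := key u hu0 hU
  have hB := key v hv0 hV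
  set R := √((∑ c, u c * x c) / U) with hR
  set S := √((∑ c, v c * x c) / V) with hS
  set A := ∑ c, u c * y c * r c with hAdef
  set B := ∑ c, v c * y c * r c with hBdef
  have hR0 : 0 ≤ R := Real.sqrt_nonneg _
  have hS0 : 0 ≤ S := Real.sqrt_nonneg _
  have hA0 : 0 ≤ A := Finset.sum_nonneg fun c _ =>
    mul_nonneg (mul_nonneg (hu0 c) (hy c).le) (hr0 c)
  have hB0 : 0 ≤ B := Finset.sum_nonneg fun c _ =>
    mul_nonneg (mul_nonneg (hv0 c) (hy c).le) (hr0 c)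
  have hR2 : U * R ^ 2 = ∑ c, u c * y c * r c ^ 2 := by
    rw [hR, Real.sq_sqrt (div_nonneg (Finset.sum_nonneg fun c _ =>
      mul_nonneg (hu0 c) (hx c)) hU.le), mul_div_cancel₀ _ hU.ne']
    refine Finset.sum_congr rfl fun c _ => ?_
    rw [hr2]; field_simp [(hy c).ne']
  have hS2 : V * S ^ 2 = ∑ c, v c * y c * r c ^ 2 := by
    rw [hS, Real.sq_sqrt (div_nonneg (Finset.sum_nonneg fun c _ =>
      mul_nonneg (hv0 c) (hx c)) hV.le), mul_div_cancel₀ _ hV.ne']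
    refine Finset.sum_congr rfl fun c _ => ?_
    rw [hr2]; field_simp [(hy c).ne']
  have hAB : A * B ≤ U * R * (V * S) := mul_le_mul hA hB hB0 (by positivity)
  have hmain : U * V * (R - S) ^ 2 ≤
      ∑ c, ∑ c', (u c * y c) * (v c' * y c') * (r c - r c') ^ 2 := by
    have : ∑ c, ∑ c', (u c * y c) * (v c' * y c') * (r c - r c') ^ 2 =
        (∑ c, u c * y c * r c ^ 2) * V + U * (∑ c, v c * y c * r c ^ 2) - 2 * (A * B) := by
      rw [hUdef, hVdef, hAdef, hBdef]
      rw [Finset.sum_mul_sum, Finset.sum_mul_sum, Finset.sum_mul_sum]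
      simp only [Finset.mul_sum, ← Finset.sum_add_distrib, ← Finset.sum_sub_distrib]
      exact Finset.sum_congr rfl fun c _ => Finset.sum_congr rfl fun c' _ => by ring
    rw [this, ← hR2, ← hS2]
    nlinarith
  have hUV : 0 < √(U * V) := Real.sqrt_pos.2 (mul_pos hU hV)
  have hsq : √(U * V) * √(U * V) = U * V := Real.mul_self_sqrt (mul_pos hU hV).le
  have hgoal : √(U * V) * geomDefect U V (∑ c, u c * x c) (∑ c, v c * x c) ≤
      √(U * V) * ∑ c, ∑ c', geomDefect (y c) (y c') (x c) (x c') := by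
    calc _ = U * V * (R - S) ^ 2 := by rw [geomDefect, ← mul_assoc, hsq]
      _ ≤ _ := hmain
      _ ≤ _ := by
        rw [Finset.mul_sum]
        refine Finset.sum_le_sum fun c _ => ?_
        rw [Finset.mul_sum]
        refine Finset.sum_le_sum fun c' _ => ?_
        rw [geomDefect, ← mul_assoc (√(U * V))]
        refine mul_le_mul_of_nonneg_right ?_ (sq_nonneg _)
        have h1 : u c * y c ≤ U := Finset.single_le_sum
          (f := fun c => u c * y c) (fun c _ => mul_nonneg (hu0 c) (hy c).le) (Finset.mem_univ c)
        have h2 : v c' * y c' ≤ V := Finset.single_le_sum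
          (f := fun c => v c * y c) (fun c _ => mul_nonneg (hv0 c) (hy c).le) (Finset.mem_univ c')
        have h3 : u c * y c ≤ y c := mul_le_of_le_one_left (hy c).le (hu1 c)
        have h4 : v c' * y c' ≤ y c' := mul_le_of_le_one_left (hy c').le (hv1 c')
        have p1 := mul_nonneg (hu0 c) (hy c).le
        have p2 := mul_nonneg (hv0 c') (hy c').le
        set s := u c * y c
        set t := v c' * y c'
        calc s * t = √(s * t) * √(s * t) := (Real.mul_self_sqrt (mul_nonneg p1 p2)).symm
          _ ≤ _ := mul_le_mul (Real.sqrt_le_sqrt (mul_le_mul h1 h2 p2 hU.le))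
            (Real.sqrt_le_sqrt (mul_le_mul h3 h4 p2 (hy c).le)) (Real.sqrt_nonneg _)
            (Real.sqrt_nonneg _)
  exact le_of_mul_le_mul_left hgoal hUV

theorem mixRows_channel {ι α β : Type*} [Fintype ι] [Fintype α] {M : ι → ι → ℝ}
    {P : ι → α → ℝ} {Q : ι → β → ℝ} {K : α → β → ℝ}
    (hPQ : ∀ c b, Q c b = ∑ a, P c a * K a b) (i : ι) (b : β) :
    mixRows M Q i b = ∑ a, mixRows M P i a * K a b := by
  simp only [mixRows, hPQ, Finset.mul_sum, Finset.sum_mul, mul_assoc]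
  exact Finset.sum_comm

theorem mixRows_pos {ι α : Type*} [Fintype ι] {M : ι → ι → ℝ} {P : ι → α → ℝ}
    (hM : ∀ i c, 0 < M i c) (hP : ∀ c a, 0 < P c a) (i : ι) (a : α) : 0 < mixRows M P i a :=
  Finset.sum_pos (fun c _ => mul_pos (hM i c) (hP c a)) ⟨i, Finset.mem_univ i⟩

theorem bhatt_mixRows_sub_le {ι α β : Type*} [Fintype ι] [Fintype α] [Fintype β]
    {M : ι → ι → ℝ} {P : ι → α → ℝ} {Q : ι → β → ℝ} {K : α → β → ℝ}
    (hM0 : ∀ i c, 0 < M i c) (hM1 : ∀ i c, M i c ≤ 1)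
    (hP : ∀ c a, 0 ≤ P c a) (hQ : ∀ c b, 0 < Q c b) (hK0 : ∀ a b, 0 ≤ K a b)
    (hK : ∀ a, ∑ b, K a b = 1) (hPQ : ∀ c b, Q c b = ∑ a, P c a * K a b) (i j : ι) :
    bhatt (mixRows M Q i) (mixRows M Q j) - bhatt (mixRows M P i) (mixRows M P j) ≤
      ∑ c, ∑ c', (bhatt (Q c) (Q c') - bhatt (P c) (P c')) := by
  have hMP : ∀ i a, 0 ≤ mixRows M P i a := fun i a =>
    Finset.sum_nonneg fun c _ => mul_nonneg (hM0 i c).le (hP c a)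
  have hMQ := mixRows_pos hM0 hQ
  have h1 := two_mul_bhatt_sub_bhatt (hMP i) (hMP j) (hMQ i) (hMQ j) hK
    (mixRows_channel hPQ i) (mixRows_channel hPQ j)
  have h2 : ∀ c c', 2 * (bhatt (Q c) (Q c') - bhatt (P c) (P c')) = _ := fun c c' =>
    two_mul_bhatt_sub_bhatt (hP c) (hP c') (hQ c) (hQ c') hK (hPQ c) (hPQ c')
  refine le_of_mul_le_mul_left (a := (2 : ℝ)) ?_ two_pos
  rw [h1]
  simp only [Finset.mul_sum, h2]
  calc _ ≤ ∑ a, ∑ b, K a b * ∑ c, ∑ c', geomDefect (Q c b) (Q c' b) (P c a) (P c' a) :=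
        Finset.sum_le_sum fun a _ => Finset.sum_le_sum fun b _ =>
          mul_le_mul_of_nonneg_left
            (geomDefect_mix_le (fun c => (hM0 i c).le) (hM1 i) (fun c => (hM0 j c).le) (hM1 j)
              (fun c => hP c a) (fun c => hQ c b) (hMQ i b) (hMQ j b)) (hK0 a b)
    _ = _ := by
        simp only [Finset.mul_sum]
        rw [Finset.sum_congr rfl fun a _ => Finset.sum_comm, Finset.sum_comm]
        refine Finset.sum_congr rfl fun c _ => ?_
        rw [Finset.sum_congr rfl fun a _ => Finset.sum_congr rfl fun b _ => rfl,
          Finset.sum_congr rfl fun a _ => Finset.sum_comm, Finset.sum_comm]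

theorem sq_sum_abs_sub_le {α : Type*} [Fintype α] {P Q : α → ℝ} (hP : ∀ a, 0 ≤ P a)
    (hQ : ∀ a, 0 ≤ Q a) (hP1 : ∑ a, P a = 1) (hQ1 : ∑ a, Q a = 1) :
    (∑ a, |P a - Q a|) ^ 2 ≤ 4 * (1 - bhatt P Q ^ 2) := by
  have h := Finset.sum_mul_sq_le_sq_mul_sq Finset.univ (fun a => |√(P a) - √(Q a)|)
    (fun a => √(P a) + √(Q a))
  have e1 : ∀ a, |√(P a) - √(Q a)| * (√(P a) + √(Q a)) = |P a - Q a| := fun a => by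
    have : (0 : ℝ) ≤ √(P a) + √(Q a) := by positivity
    nth_rewrite 1 [← abs_of_nonneg this]
    rw [← abs_mul]
    congr 1
    linear_combination Real.sq_sqrt (hP a) - Real.sq_sqrt (hQ a)
  have e2 : ∑ a, |√(P a) - √(Q a)| ^ 2 = 2 - 2 * bhatt P Q := by
    have : ∀ a, |√(P a) - √(Q a)| ^ 2 = P a + Q a - 2 * √(P a * Q a) := fun a => by
      rw [sq_abs, Real.sqrt_mul (hP a)]
      linear_combination Real.sq_sqrt (hP a) + Real.sq_sqrt (hQ a)
    simp only [this, Finset.sum_sub_distrib, Finset.sum_add_distrib, hP1, hQ1, bhatt,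
      ← Finset.mul_sum]
    ring
  have e3 : ∑ a, (√(P a) + √(Q a)) ^ 2 = 2 + 2 * bhatt P Q := by
    have : ∀ a, (√(P a) + √(Q a)) ^ 2 = P a + Q a + 2 * √(P a * Q a) := fun a => by
      rw [Real.sqrt_mul (hP a)]
      linear_combination Real.sq_sqrt (hP a) + Real.sq_sqrt (hQ a)
    simp only [this, Finset.sum_add_distrib, hP1, hQ1, bhatt, ← Finset.mul_sum]
    ring
  simp only [e1, e2, e3] at h
  linarith

theorem two_sub_two_mul_bhatt_le {α : Type*} [Fintype α] {P Q : α → ℝ} (hP : ∀ a, 0 ≤ P a)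
    (hQ : ∀ a, 0 ≤ Q a) (hP1 : ∑ a, P a = 1) (hQ1 : ∑ a, Q a = 1) :
    2 - 2 * bhatt P Q ≤ ∑ a, |P a - Q a| := by
  have : ∀ a, P a + Q a - 2 * √(P a * Q a) ≤ |P a - Q a| := fun a => by
    rw [Real.sqrt_mul (hP a)]
    have hp := Real.sq_sqrt (hP a)
    have hq := Real.sq_sqrt (hQ a)
    have p := Real.sqrt_nonneg (P a)
    have q := Real.sqrt_nonneg (Q a)
    rcases le_total (√(P a)) (√(Q a)) with h | h
    · have := neg_abs_le (P a - Q a)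
      nlinarith
    · have := le_abs_self (P a - Q a)
      nlinarith
  calc _ = ∑ a, (P a + Q a - 2 * √(P a * Q a)) := by
        simp only [Finset.sum_sub_distrib, Finset.sum_add_distrib, hP1, hQ1, bhatt,
          ← Finset.mul_sum]
        ring
    _ ≤ _ := Finset.sum_le_sum fun a _ => this a

theorem bhatt_pi {ι α : Type*} [Fintype ι] [DecidableEq ι] [Fintype α] {P Q : α → ℝ}
    (hP : ∀ a, 0 ≤ P a) (hQ : ∀ a, 0 ≤ Q a) :
    bhatt (fun a : ι → α => ∏ i, P (a i)) (fun a => ∏ i, Q (a i)) =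
      bhatt P Q ^ Fintype.card ι := by
  unfold bhatt
  rw [← Finset.card_univ, ← Finset.prod_const, Fintype.prod_sum]
  refine Finset.sum_congr rfl fun a _ => ?_
  rw [← Finset.prod_mul_distrib, Real.sqrt_prod _ fun i _ => mul_nonneg (hP _) (hQ _)]

theorem pow_sub_pow_le_mul {a b : ℝ} (ha : 0 ≤ a) (hab : a ≤ b) (d : ℕ) :
    b ^ d - a ^ d ≤ d * b ^ (d - 1) * (b - a) := by
  have h := abs_pow_sub_pow_le b a d
  rw [abs_of_nonneg (sub_nonneg.2 (pow_le_pow_left₀ ha hab d)),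
    abs_of_nonneg (sub_nonneg.2 hab), abs_of_nonneg ha, abs_of_nonneg (ha.trans hab),
    max_eq_left hab] at h
  linarith

theorem sub_le_geomDefect {y y' x x' s : ℝ} (hy : 0 < y) (hyy' : y ≤ y') (hx : 0 ≤ x)
    (hx' : 0 ≤ x') (hs : 0 < s) :
    x - x' ≤ geomDefect y y' x x' / (2 * s) + s * (x + x') := by
  have hy' := hy.trans_le hyy'
  have hD := geomDefect_nonneg y y' x x'
  by_cases hr : √(x' / y') ≤ √(x / y)
  · set r := √(x / y) with hrdef
    set r' := √(x' / y') with hrdef'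
    have hr0 : 0 ≤ r' := Real.sqrt_nonneg _
    have e1 : x = y * r ^ 2 := by rw [Real.sq_sqrt (by positivity)]; field_simp
    have e2 : x' = y' * r' ^ 2 := by rw [Real.sq_sqrt (by positivity)]; field_simp
    have hsq : y ≤ √(y * y') := by
      apply Real.le_sqrt_of_sq_le; nlinarith
    have h1 : y * (r - r') ^ 2 ≤ geomDefect y y' x x' :=
      mul_le_mul_of_nonneg_right hsq (sq_nonneg _)
    have h2 : y * r' ^ 2 ≤ y' * r' ^ 2 := mul_le_mul_of_nonneg_right hyy' (sq_nonneg _)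
    have h3 : x - x' ≤ y * ((r - r') * (r + r')) := by nlinarith
    have h4 : (r - r') * (r + r') ≤ (r - r') ^ 2 / (2 * s) + s * (r ^ 2 + r' ^ 2) := by
      have : 0 ≤ (r - r' - s * (r + r')) ^ 2 / (2 * s) + s * (r - r') ^ 2 / 2 := by positivity
      have e : (r - r') ^ 2 / (2 * s) + s * (r ^ 2 + r' ^ 2) - (r - r') * (r + r') =
        (r - r' - s * (r + r')) ^ 2 / (2 * s) + s * (r - r') ^ 2 / 2 := by
        field_simp; ring
      linarith
    calc x - x' ≤ y * ((r - r') * (r + r')) := h3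
      _ ≤ y * ((r - r') ^ 2 / (2 * s) + s * (r ^ 2 + r' ^ 2)) :=
        mul_le_mul_of_nonneg_left h4 hy.le
      _ = y * (r - r') ^ 2 / (2 * s) + s * (y * r ^ 2 + y * r' ^ 2) := by ring
      _ ≤ _ := by
        gcongr
        · exact e1.ge
        · exact e2 ▸ h2
  · have hlt := Real.sqrt_lt_sqrt_iff (div_nonneg hx hy.le) |>.1 (not_le.1 hr)
    have : x ≤ x' := by
      rw [div_lt_div_iff₀ hy hy'] at hlt
      nlinarith
    have : 0 ≤ geomDefect y y' x x' / (2 * s) + s * (x + x') := by positivity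
    linarith

/-- A channel `K` turning `P` into `Q` loses little in the optimal success probability if it
changes the pairwise Bhattacharyya coefficients little. -/
theorem sum_iSup_sub_le {ι α β : Type*} [Fintype ι] [Nonempty ι] [Fintype α] [Fintype β]
    {P : ι → α → ℝ} {Q : ι → β → ℝ} {K : α → β → ℝ}
    (hP : ∀ c a, 0 ≤ P c a) (hP1 : ∀ c, ∑ a, P c a = 1)
    (hQ : ∀ c b, 0 < Q c b) (hK0 : ∀ a b, 0 ≤ K a b)
    (hK : ∀ a, ∑ b, K a b = 1) (hPQ : ∀ c b, Q c b = ∑ a, P c a * K a b) {s : ℝ} (hs : 0 < s) :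
    (∑ a, ⨆ i, P i a) - ∑ b, ⨆ i, Q i b ≤
      (∑ c, ∑ c', (bhatt (Q c) (Q c') - bhatt (P c) (P c'))) / s
        + 2 * s * Fintype.card ι := by
  choose j hj using fun b => exists_eq_ciSup_of_finite (f := fun i => Q i b)
  have hjmax : ∀ i b, Q i b ≤ Q (j b) b := fun i b => by
    rw [hj b]; exact le_ciSup (f := fun i => Q i b) (Set.finite_range _).bddAbove i
  have hpt : ∀ a b, ⨆ i, P i a ≤ P (j b) a +
      (∑ c, ∑ c', geomDefect (Q c b) (Q c' b) (P c a) (P c' a)) / (2 * s) +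
        s * (2 * ∑ c, P c a) := by
    intro a b
    refine ciSup_le fun i => ?_
    have h := sub_le_geomDefect (hQ i b) (hjmax i b) (hP i a) (hP (j b) a) hs
    have h1 : geomDefect (Q i b) (Q (j b) b) (P i a) (P (j b) a) ≤
        ∑ c, ∑ c', geomDefect (Q c b) (Q c' b) (P c a) (P c' a) :=
      (Finset.single_le_sum (f := fun c' => geomDefect (Q i b) (Q c' b) (P i a) (P c' a))
        (fun _ _ => geomDefect_nonneg _ _ _ _) (Finset.mem_univ (j b))).trans
      (Finset.single_le_sum
        (f := fun c => ∑ c', geomDefect (Q c b) (Q c' b) (P c a) (P c' a))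
        (fun _ _ => Finset.sum_nonneg fun _ _ => geomDefect_nonneg _ _ _ _) (Finset.mem_univ i))
    have h2 : ∀ k, P k a ≤ ∑ c, P c a := fun k =>
      Finset.single_le_sum (f := fun c => P c a) (fun c _ => hP c a) (Finset.mem_univ k)
    have h3 : s * (P i a + P (j b) a) ≤ s * (2 * ∑ c, P c a) :=
      mul_le_mul_of_nonneg_left (by linarith [h2 i, h2 (j b)]) hs.le
    have h4 := div_le_div_of_nonneg_right h1 (by positivity : (0 : ℝ) ≤ 2 * s)
    linarith
  have hsum : ∑ a, ⨆ i, P i a ≤ ∑ a, ∑ b, K a b * (P (j b) a +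
      (∑ c, ∑ c', geomDefect (Q c b) (Q c' b) (P c a) (P c' a)) / (2 * s) +
        s * (2 * ∑ c, P c a)) := by
    refine Finset.sum_le_sum fun a _ => ?_
    calc ⨆ i, P i a = ∑ b, K a b * ⨆ i, P i a := by rw [← Finset.sum_mul, hK, one_mul]
      _ ≤ _ := Finset.sum_le_sum fun b _ => mul_le_mul_of_nonneg_left (hpt a b) (hK0 a b)
  have t1 : ∑ a, ∑ b, K a b * P (j b) a = ∑ b, ⨆ i, Q i b := by
    rw [Finset.sum_comm]
    refine Finset.sum_congr rfl fun b _ => ?_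
    rw [← hj b, hPQ]
    exact Finset.sum_congr rfl fun a _ => mul_comm _ _
  have t2 : ∑ a, ∑ b, K a b * ((∑ c, ∑ c', geomDefect (Q c b) (Q c' b) (P c a) (P c' a))
      / (2 * s)) = (∑ c, ∑ c', (bhatt (Q c) (Q c') - bhatt (P c) (P c'))) / s := by
    have h2 : ∀ c c', bhatt (Q c) (Q c') - bhatt (P c) (P c') =
        (∑ a, ∑ b, K a b * geomDefect (Q c b) (Q c' b) (P c a) (P c' a)) / 2 := fun c c' => by
      rw [← two_mul_bhatt_sub_bhatt (hP c) (hP c') (hQ c) (hQ c') hK (hPQ c) (hPQ c')]; ring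
    simp only [h2, mul_div_assoc', ← Finset.sum_div]
    rw [div_div]
    congr 1
    simp only [Finset.mul_sum]
    rw [Finset.sum_congr rfl fun a _ => Finset.sum_comm, Finset.sum_comm]
    refine Finset.sum_congr rfl fun c _ => ?_
    rw [Finset.sum_congr rfl fun a _ => Finset.sum_congr rfl fun b _ => rfl,
      Finset.sum_congr rfl fun a _ => Finset.sum_comm, Finset.sum_comm]
  have t3 : ∑ a, ∑ b, K a b * (s * (2 * ∑ c, P c a)) = 2 * s * Fintype.card ι := by
    simp only [← Finset.sum_mul, hK, one_mul, ← Finset.mul_sum]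
    rw [Finset.sum_comm]
    simp [hP1]
    ring
  simp only [mul_add, Finset.sum_add_distrib] at hsum
  rw [t1, t2, t3] at hsum
  linarith

theorem sum_iSup_channel_le {ι α β : Type*} [Fintype ι] [Nonempty ι] [Fintype α] [Fintype β]
    {P : ι → α → ℝ} {Q : ι → β → ℝ} {K : α → β → ℝ} (hK0 : ∀ a b, 0 ≤ K a b)
    (hK : ∀ a, ∑ b, K a b = 1) (hPQ : ∀ c b, Q c b = ∑ a, P c a * K a b) :
    ∑ b, ⨆ i, Q i b ≤ ∑ a, ⨆ i, P i a := by
  calc ∑ b, ⨆ i, Q i b ≤ ∑ b, ∑ a, (⨆ i, P i a) * K a b := by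
        refine Finset.sum_le_sum fun b _ => ciSup_le fun i => ?_
        rw [hPQ]
        exact Finset.sum_le_sum fun a _ => mul_le_mul_of_nonneg_right
          (le_ciSup (f := fun i => P i a) (Set.finite_range _).bddAbove i) (hK0 a b)
    _ = _ := by
        rw [Finset.sum_comm]
        simp only [← Finset.mul_sum, hK, mul_one]

/-- The likelihood, given the root label, of a labelling of depth `m` obtained by broadcasting
with transition matrix `M` and then observing each label at depth `m` through `B`. -/
noncomputable def leafLik {q d : ℕ} (M B : Fin q → Fin q → ℝ) :
    (m : ℕ) → Fin q → ((Fin m → Fin d) → Fin q) → ℝ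
  | 0, c, a => B c (a default)
  | m + 1, c, a => ∏ i : Fin d,
      mixRows M (leafLik M B m) c fun f => a (Fin.snoc (α := fun _ => Fin d) f i)

/-- The channel applying `B` independently to each label at depth `m`. -/
noncomputable def leafNoise {q d : ℕ} (B : Fin q → Fin q → ℝ) :
    (m : ℕ) → ((Fin m → Fin d) → Fin q) → ((Fin m → Fin d) → Fin q) → ℝ
  | 0, a, b => B (a default) (b default)
  | m + 1, a, b => ∏ i : Fin d, leafNoise B m
      (fun f => a (Fin.snoc (α := fun _ => Fin d) f i))
      (fun f => b (Fin.snoc (α := fun _ => Fin d) f i))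

/-- Labellings of depth `m + 1` are families of labellings of depth `m` of the subtrees of the
root. -/
def leafSplit (q d m : ℕ) :
    ((Fin (m + 1) → Fin d) → Fin q) ≃ (Fin d → (Fin m → Fin d) → Fin q) :=
  ((Fin.snocEquiv fun _ : Fin (m + 1) => Fin d).symm.arrowCongr (Equiv.refl (Fin q))).trans
    (Equiv.curry (Fin d) (Fin m → Fin d) (Fin q))

theorem sum_prod_leafSplit {q d m : ℕ} (F : Fin d → ((Fin m → Fin d) → Fin q) → ℝ) :
    ∑ a : (Fin (m + 1) → Fin d) → Fin q, ∏ i,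
      F i (fun f => a (Fin.snoc (α := fun _ => Fin d) f i)) = ∏ i, ∑ a, F i a := by
  rw [Fintype.prod_sum]
  exact Fintype.sum_equiv (leafSplit q d m) _ _ fun a => rfl

theorem mixRows_nonneg {ι α : Type*} [Fintype ι] {M : ι → ι → ℝ} {P : ι → α → ℝ}
    (hM : ∀ i c, 0 ≤ M i c) (hP : ∀ c a, 0 ≤ P c a) (i : ι) (a : α) : 0 ≤ mixRows M P i a :=
  Finset.sum_nonneg fun c _ => mul_nonneg (hM i c) (hP c a)

theorem sum_mixRows {ι α : Type*} [Fintype ι] [Fintype α] {M : ι → ι → ℝ} {P : ι → α → ℝ}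
    (hM : ∀ i, ∑ c, M i c = 1) (hP : ∀ c, ∑ a, P c a = 1) (i : ι) :
    ∑ a, mixRows M P i a = 1 := by
  unfold mixRows
  rw [Finset.sum_comm]
  simp only [← Finset.mul_sum, hP, mul_one, hM]

section

variable {q d : ℕ} {M B : Fin q → Fin q → ℝ}

theorem leafLik_nonneg (hM : ∀ i c, 0 ≤ M i c) (hB : ∀ i c, 0 ≤ B i c) (m : ℕ) (c : Fin q)
    (a : (Fin m → Fin d) → Fin q) : 0 ≤ leafLik M B m c a := by
  induction m generalizing c with
  | zero => exact hB _ _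
  | succ m ih => exact Finset.prod_nonneg fun i _ => mixRows_nonneg hM (fun c a => ih c a) _ _

theorem sum_leafZero (F : Fin q → ℝ) :
    ∑ a : (Fin 0 → Fin d) → Fin q, F (a default) = ∑ c, F c :=
  Fintype.sum_equiv (Equiv.funUnique (Fin 0 → Fin d) (Fin q)) _ _ fun _ => rfl

theorem sum_leafLik (hM : ∀ i, ∑ c, M i c = 1) (hB : ∀ i, ∑ c, B i c = 1) (m : ℕ)
    (c : Fin q) : ∑ a : (Fin m → Fin d) → Fin q, leafLik M B m c a = 1 := by
  induction m generalizing c with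
  | zero => exact (sum_leafZero (B c)).trans (hB c)
  | succ m ih =>
    simp only [leafLik]
    rw [sum_prod_leafSplit fun _ => mixRows M (leafLik M B m) c]
    simp [sum_mixRows hM ih]

theorem leafLik_succ_pos (hM : ∀ i c, 0 < M i c) (hB : ∀ i c, 0 ≤ B i c)
    (hB' : ∀ c, 0 < ∑ i, B i c) (m : ℕ) (c : Fin q) (a : (Fin (m + 1) → Fin d) → Fin q) :
    0 < leafLik M B (m + 1) c a := by
  have h0 := leafLik_nonneg (d := d) (fun i c => (hM i c).le) hB
  induction m generalizing c with
  | zero =>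
    refine Finset.prod_pos fun i _ => ?_
    obtain ⟨c', -, hc'⟩ := (Finset.sum_pos_iff_of_nonneg fun i _ => hB i _).1
      (hB' (a (Fin.snoc (α := fun _ => Fin d) default i)))
    exact Finset.sum_pos' (fun c _ => mul_nonneg (hM _ c).le (h0 _ _ _))
      ⟨c', Finset.mem_univ _, mul_pos (hM _ _) hc'⟩
  | succ m ih =>
    exact Finset.prod_pos fun i _ =>
      Finset.sum_pos (fun c' _ => mul_pos (hM _ _) (ih c' _)) ⟨c, Finset.mem_univ _⟩

theorem leafNoise_nonneg (hB : ∀ i c, 0 ≤ B i c) (m : ℕ) (a b : (Fin m → Fin d) → Fin q) :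
    0 ≤ leafNoise B m a b := by
  induction m with
  | zero => exact hB _ _
  | succ m ih => exact Finset.prod_nonneg fun i _ => ih _ _

theorem sum_leafNoise (hB : ∀ i, ∑ c, B i c = 1) (m : ℕ) (a : (Fin m → Fin d) → Fin q) :
    ∑ b, leafNoise B m a b = 1 := by
  induction m with
  | zero => exact (sum_leafZero (B (a default))).trans (hB _)
  | succ m ih =>
    simp only [leafNoise]
    rw [sum_prod_leafSplit fun i => leafNoise B m
      (fun f => a (Fin.snoc (α := fun _ => Fin d) f i))]
    simp [ih]

theorem leafLik_channel (m : ℕ) (c : Fin q) (b : (Fin m → Fin d) → Fin q) :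
    leafLik M B m c b =
      ∑ a, leafLik M (fun i j => if i = j then 1 else 0) m c a * leafNoise B m a b := by
  induction m generalizing c with
  | zero =>
    simp only [leafLik, leafNoise]
    rw [sum_leafZero (d := d) fun x => (if c = x then 1 else 0) * B x (b default)]
    simp
  | succ m ih =>
    simp only [leafLik, leafNoise, ← Finset.prod_mul_distrib]
    rw [sum_prod_leafSplit fun i a => mixRows M (leafLik M (fun i j => if i = j then 1 else 0) m) c
      a * leafNoise B m a (fun f => b (Fin.snoc (α := fun _ => Fin d) f i))]
    exact Finset.prod_congr rfl fun i _ => mixRows_channel ih c _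

theorem bhatt_leafLik_succ (hM : ∀ i c, 0 ≤ M i c) (hB : ∀ i c, 0 ≤ B i c) (m : ℕ)
    (i j : Fin q) :
    bhatt (leafLik (d := d) M B (m + 1) i) (leafLik M B (m + 1) j) =
      bhatt (mixRows M (leafLik (d := d) M B m) i) (mixRows M (leafLik M B m) j) ^ d := by
  have h0 := leafLik_nonneg (d := d) hM hB m
  have h := bhatt_pi (ι := Fin d) (mixRows_nonneg hM h0 i) (mixRows_nonneg hM h0 j)
  rw [Fintype.card_fin] at h
  rw [← h]
  exact Fintype.sum_equiv (leafSplit q d m) _ _ fun a => rfl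

end

theorem transM_eq {q : ℕ} (hq : 3 ≤ q) (p : ℝ) (i c : Fin q) :
    transM q p i c = (1 - p * q / ((q : ℝ) - 1)) * (if i = c then 1 else 0)
      + p / ((q : ℝ) - 1) := by
  have : (3 : ℝ) ≤ q := by exact_mod_cast hq
  have : (q : ℝ) - 1 ≠ 0 := by linarith
  unfold transM
  split_ifs <;> field_simp <;> ring

theorem transM_pos {q : ℕ} (hq : 3 ≤ q) {p : ℝ} (hp : 0 < p) (hp1 : p < 1) (i c : Fin q) :
    0 < transM q p i c := by
  have : (3 : ℝ) ≤ q := by exact_mod_cast hq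
  unfold transM
  split_ifs
  · linarith
  · exact div_pos hp (by linarith)

theorem transM_le_one {q : ℕ} (hq : 3 ≤ q) {p : ℝ} (hp : 0 < p) (hp1 : p < 1) (i c : Fin q) :
    transM q p i c ≤ 1 := by
  have : (3 : ℝ) ≤ q := by exact_mod_cast hq
  unfold transM
  split_ifs
  · linarith
  · rw [div_le_one (by linarith)]; linarith

theorem mixRows_transM {q : ℕ} (hq : 3 ≤ q) (p : ℝ) {α : Type*} (P : Fin q → α → ℝ)
    (i : Fin q) (a : α) :
    mixRows (transM q p) P i a =
      (1 - p * q / ((q : ℝ) - 1)) * P i a + p / ((q : ℝ) - 1) * ∑ c, P c a := by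
  simp only [mixRows, transM_eq hq, add_mul, Finset.sum_add_distrib, ← Finset.mul_sum, mul_assoc]
  simp

theorem sum_transM {q : ℕ} (hq : 3 ≤ q) (p : ℝ) (i : Fin q) : ∑ c, transM q p i c = 1 := by
  have h := mixRows_transM hq p (α := Unit) (fun _ _ => 1) i ()
  have : (3 : ℝ) ≤ q := by exact_mod_cast hq
  have : (q : ℝ) - 1 ≠ 0 := by linarith
  simp only [mixRows, mul_one] at h
  rw [h]
  simp
  field_simp
  ring

theorem sum_abs_mixRows_transM_sub {q : ℕ} (hq : 3 ≤ q) (p : ℝ) {α : Type*} [Fintype α]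
    (P : Fin q → α → ℝ) (i j : Fin q) :
    ∑ a, |mixRows (transM q p) P i a - mixRows (transM q p) P j a| =
      |1 - p * q / ((q : ℝ) - 1)| * ∑ a, |P i a - P j a| := by
  simp only [mixRows_transM hq, Finset.mul_sum, ← abs_mul]
  exact Finset.sum_congr rfl fun a _ => by congr 1; ring

theorem bhatt_mixRows_transM_le {q : ℕ} (hq : 3 ≤ q) {p lam : ℝ} (hp : 0 < p) (hp1 : p < 1)
    (hlam : lam = 1 - p * q / ((q : ℝ) - 1)) {α : Type*} [Fintype α] {P : Fin q → α → ℝ}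
    (hP : ∀ c a, 0 ≤ P c a) (hP1 : ∀ c, ∑ a, P c a = 1) {i j : Fin q}
    (hij : 2 / 3 ≤ ∑ a, |P i a - P j a|) :
    bhatt (mixRows (transM q p) P i) (mixRows (transM q p) P j) ≤ Real.exp (-(lam ^ 2 / 18)) := by
  have hM0 : ∀ i c, 0 ≤ transM q p i c := fun i c => (transM_pos hq hp hp1 i c).le
  have h := sq_sum_abs_sub_le (mixRows_nonneg hM0 hP i) (mixRows_nonneg hM0 hP j)
    (sum_mixRows (sum_transM hq p) hP1 i) (sum_mixRows (sum_transM hq p) hP1 j)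
  rw [sum_abs_mixRows_transM_sub hq, ← hlam, mul_pow, sq_abs] at h
  have h2 : (2 / 3 : ℝ) ^ 2 ≤ (∑ a, |P i a - P j a|) ^ 2 :=
    pow_le_pow_left₀ (by norm_num) hij 2
  have h3 := mul_le_mul_of_nonneg_left h2 (sq_nonneg lam)
  refine le_of_sq_le_sq ?_ (Real.exp_pos _).le
  rw [← Real.exp_nat_mul]
  have h4 := Real.add_one_le_exp (((2 : ℕ) : ℝ) * -(lam ^ 2 / 18))
  push_cast at h4 ⊢
  linarith

theorem two_thirds_le_sum_abs_leafLik_sub {q d : ℕ} (hq : 3 ≤ q) {p lam : ℝ} (hp : 0 < p)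
    (hp1 : p < 1) (hlam : lam = 1 - p * q / ((q : ℝ) - 1)) {Δ : Fin q → Fin q → ℝ}
    (hΔ0 : ∀ i j, 0 ≤ Δ i j) (hrow : ∀ i, ∑ j, Δ i j = 1) (hcol : ∀ j, ∑ i, Δ i j = 1)
    (hdiag : ∀ i, 1 - 1 / (q : ℝ) ≤ Δ i i) (hd : Real.exp (-(lam ^ 2 / 18)) ^ d ≤ 1 / 2)
    (m : ℕ) {i j : Fin q} (hij : i ≠ j) :
    2 / 3 ≤ ∑ a : (Fin m → Fin d) → Fin q,
      |leafLik (transM q p) Δ m i a - leafLik (transM q p) Δ m j a| := by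
  have hM0 : ∀ i c, 0 ≤ transM q p i c := fun i c => (transM_pos hq hp hp1 i c).le
  have h0 := leafLik_nonneg (d := d) hM0 hΔ0
  have h1 := sum_leafLik (d := d) (sum_transM hq p) hrow
  induction m with
  | zero =>
    refine le_of_le_of_eq ?_ (sum_leafZero (d := d) fun c => |Δ i c - Δ j c|).symm
    have hq3 : (1 : ℝ) / q ≤ 1 / 3 := by
      have : (3 : ℝ) ≤ q := by exact_mod_cast hq
      exact one_div_le_one_div_of_le (by norm_num) this
    have key : ∀ i j : Fin q, i ≠ j → 1 / 3 ≤ |Δ i i - Δ j i| := fun i j hij => by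
      have h := Finset.sum_le_sum_of_subset_of_nonneg (Finset.subset_univ {i, j})
        fun c _ _ => hΔ0 c i
      rw [Finset.sum_pair hij, hcol] at h
      have := le_abs_self (Δ i i - Δ j i)
      have := hdiag i
      linarith
    have h := Finset.sum_le_sum_of_subset_of_nonneg (Finset.subset_univ {i, j})
      fun c _ _ => abs_nonneg (Δ i c - Δ j c)
    rw [Finset.sum_pair hij] at h
    have h2 := key j i hij.symm
    rw [abs_sub_comm] at h2
    linarith [key i j hij]
  | succ m ih =>
    have h := two_sub_two_mul_bhatt_le (h0 (m + 1) i) (h0 (m + 1) j) (h1 _ i) (h1 _ j)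
    rw [bhatt_leafLik_succ hM0 hΔ0] at h
    have hb := bhatt_mixRows_transM_le hq hp hp1 hlam (h0 m) (h1 m) ih
    have hb0 : 0 ≤ bhatt (mixRows (transM q p) (leafLik (d := d) (transM q p) Δ m) i)
        (mixRows (transM q p) (leafLik (transM q p) Δ m) j) :=
      Finset.sum_nonneg fun _ _ => Real.sqrt_nonneg _
    have := pow_le_pow_left₀ hb0 hb d
    linarith

/-- The increase of the pairwise Bhattacharyya coefficients at depth `m` caused by the noise. -/
noncomputable def bhattGap {q : ℕ} (d : ℕ) (M Δ : Fin q → Fin q → ℝ) (m : ℕ)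
    (i j : Fin q) : ℝ :=
  bhatt (leafLik (d := d) M Δ m i) (leafLik M Δ m j) -
    bhatt (leafLik (d := d) M (fun i j => if i = j then 1 else 0) m i)
      (leafLik M (fun i j => if i = j then 1 else 0) m j)

theorem sum_bhattGap_succ_le {q d : ℕ} (hq : 3 ≤ q) {p lam : ℝ} (hp : 0 < p)
    (hp1 : p < 1) (hlam : lam = 1 - p * q / ((q : ℝ) - 1)) {Δ : Fin q → Fin q → ℝ}
    (hΔ0 : ∀ i j, 0 ≤ Δ i j) (hrow : ∀ i, ∑ j, Δ i j = 1) (hcol : ∀ j, ∑ i, Δ i j = 1)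
    (hdiag : ∀ i, 1 - 1 / (q : ℝ) ≤ Δ i i) (hd : Real.exp (-(lam ^ 2 / 18)) ^ d ≤ 1 / 2)
    (hd' : (q : ℝ) ^ 2 * (d * Real.exp (-(lam ^ 2 / 18)) ^ (d - 1)) ≤ 1 / 2) (m : ℕ) :
    ∑ i, ∑ j, bhattGap d (transM q p) Δ (m + 2) i j ≤
      1 / 2 * ∑ i, ∑ j, bhattGap d (transM q p) Δ (m + 1) i j := by
  have hM := transM_pos hq hp hp1
  have hM0 : ∀ i c, 0 ≤ transM q p i c := fun i c => (hM i c).le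
  have hI0 : ∀ i j : Fin q, (0 : ℝ) ≤ if i = j then 1 else 0 := fun i j => by
    split_ifs <;> norm_num
  have hI1 : ∀ i : Fin q, ∑ j, (if i = j then (1 : ℝ) else 0) = 1 := fun i => by simp
  have hP0 := leafLik_nonneg (d := d) hM0 hI0 (m + 1)
  have hQ0 := leafLik_nonneg (d := d) hM0 hΔ0 (m + 1)
  have hP1 := sum_leafLik (d := d) (sum_transM hq p) hI1 (m + 1)
  have hQ1 := sum_leafLik (d := d) (sum_transM hq p) hrow (m + 1)
  have hQpos := leafLik_succ_pos (d := d) hM hΔ0 (fun c => by rw [hcol]; norm_num) m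
  set G := ∑ i, ∑ j, bhattGap d (transM q p) Δ (m + 1) i j with hG
  have hgap0 : ∀ i j, 0 ≤ bhattGap d (transM q p) Δ (m + 1) i j := fun i j => by
    have h : 2 * bhattGap d (transM q p) Δ (m + 1) i j = _ :=
      two_mul_bhatt_sub_bhatt (hP0 i) (hP0 j) (hQpos i) (hQpos j)
        (sum_leafNoise hrow (m + 1)) (leafLik_channel (m + 1) i) (leafLik_channel (m + 1) j)
    have : (0 : ℝ) ≤ 2 * bhattGap d (transM q p) Δ (m + 1) i j := by
      rw [h]
      exact Finset.sum_nonneg fun a _ => Finset.sum_nonneg fun b _ =>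
        mul_nonneg (leafNoise_nonneg hΔ0 _ a b) (geomDefect_nonneg _ _ _ _)
    linarith
  have hG0 : 0 ≤ G := Finset.sum_nonneg fun i _ => Finset.sum_nonneg fun j _ => hgap0 i j
  set κ := Real.exp (-(lam ^ 2 / 18)) with hκ
  have hκ0 : 0 < κ := Real.exp_pos _
  have hstep : ∀ i j, bhattGap d (transM q p) Δ (m + 2) i j ≤ d * κ ^ (d - 1) * G := by
    intro i j
    rcases eq_or_ne i j with rfl | hij
    · have e : ∀ (n : ℕ) (B : Fin q → Fin q → ℝ) (_ : ∀ i j, 0 ≤ B i j)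
          (_ : ∀ i, ∑ j, B i j = 1),
          bhatt (leafLik (d := d) (transM q p) B n i) (leafLik (transM q p) B n i) = 1 := by
        intro n B hB0 hB1
        rw [← sum_leafLik (d := d) (sum_transM hq p) hB1 n i]
        exact Finset.sum_congr rfl fun a _ => Real.sqrt_mul_self (leafLik_nonneg hM0 hB0 n i a)
      rw [bhattGap, e _ _ hΔ0 hrow, e _ _ hI0 hI1, sub_self]
      positivity
    · rw [bhattGap, bhatt_leafLik_succ hM0 hΔ0, bhatt_leafLik_succ hM0 hI0]
      have h1 := bhatt_mixRows_sub_le hM (transM_le_one hq hp hp1) hP0 hQpos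
        (leafNoise_nonneg hΔ0 (m + 1)) (sum_leafNoise hrow (m + 1))
        (leafLik_channel (m + 1)) i j
      have h2 := bhatt_mixRows_transM_le hq hp hp1 hlam hQ0 hQ1
        (two_thirds_le_sum_abs_leafLik_sub hq hp hp1 hlam hΔ0 hrow hcol hdiag hd (m + 1) hij)
      have h3 := two_mul_bhatt_sub_bhatt (mixRows_nonneg hM0 hP0 i) (mixRows_nonneg hM0 hP0 j)
        (mixRows_pos hM hQpos i) (mixRows_pos hM hQpos j)
        (sum_leafNoise hrow (m + 1)) (mixRows_channel (leafLik_channel (m + 1)) i)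
        (mixRows_channel (leafLik_channel (m + 1)) j)
      have h4 : (0 : ℝ) ≤ _ := h3.symm ▸ Finset.sum_nonneg fun a _ => Finset.sum_nonneg fun b _ =>
        mul_nonneg (leafNoise_nonneg hΔ0 _ a b) (geomDefect_nonneg _ _ _ _)
      change _ ≤ G at h1
      set b := bhatt (mixRows (transM q p) (leafLik (d := d) (transM q p) Δ (m + 1)) i)
        (mixRows (transM q p) (leafLik (transM q p) Δ (m + 1)) j)
      set a := bhatt (mixRows (transM q p) (leafLik (d := d) (transM q p)
        (fun i j => if i = j then 1 else 0) (m + 1)) i)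
        (mixRows (transM q p) (leafLik (transM q p) (fun i j => if i = j then 1 else 0)
          (m + 1)) j)
      have ha : 0 ≤ a := Finset.sum_nonneg fun _ _ => Real.sqrt_nonneg _
      have hab : a ≤ b := by linarith
      calc b ^ d - a ^ d ≤ d * b ^ (d - 1) * (b - a) := pow_sub_pow_le_mul ha hab d
        _ ≤ d * κ ^ (d - 1) * G := by
          have : 0 ≤ b := ha.trans hab
          have : 0 ≤ b - a := sub_nonneg.2 hab
          gcongr
  calc _ ≤ ∑ _i : Fin q, ∑ _j : Fin q, d * κ ^ (d - 1) * G :=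
        Finset.sum_le_sum fun i _ => Finset.sum_le_sum fun j _ => hstep i j
    _ = (q : ℝ) ^ 2 * (d * κ ^ (d - 1)) * G := by
        simp only [Finset.sum_const, Finset.card_univ, Fintype.card_fin, nsmul_eq_mul]
        ring
    _ ≤ _ := mul_le_mul_of_nonneg_right hd' hG0

theorem tendsto_sum_iSup_leafLik_sub {q d : ℕ} (hq : 3 ≤ q) {p lam : ℝ} (hp : 0 < p)
    (hp1 : p < 1) (hlam : lam = 1 - p * q / ((q : ℝ) - 1)) {Δ : Fin q → Fin q → ℝ}
    (hΔ0 : ∀ i j, 0 ≤ Δ i j) (hrow : ∀ i, ∑ j, Δ i j = 1) (hcol : ∀ j, ∑ i, Δ i j = 1)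
    (hdiag : ∀ i, 1 - 1 / (q : ℝ) ≤ Δ i i) (hd : Real.exp (-(lam ^ 2 / 18)) ^ d ≤ 1 / 2)
    (hd' : (q : ℝ) ^ 2 * (d * Real.exp (-(lam ^ 2 / 18)) ^ (d - 1)) ≤ 1 / 2) :
    Tendsto (fun m : ℕ =>
      (∑ a : (Fin m → Fin d) → Fin q,
          ⨆ i, leafLik (transM q p) (fun i j => if i = j then 1 else 0) m i a) -
        ∑ a : (Fin m → Fin d) → Fin q, ⨆ i, leafLik (transM q p) Δ m i a) atTop (nhds 0) := by
  have hM := transM_pos hq hp hp1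
  have hM0 : ∀ i c, 0 ≤ transM q p i c := fun i c => (hM i c).le
  have hI0 : ∀ i j : Fin q, (0 : ℝ) ≤ if i = j then 1 else 0 := fun i j => by
    split_ifs <;> norm_num
  have hI1 : ∀ i : Fin q, ∑ j, (if i = j then (1 : ℝ) else 0) = 1 := fun i => by simp
  have : Nonempty (Fin q) := ⟨⟨0, by omega⟩⟩
  set G : ℕ → ℝ := fun m => ∑ i, ∑ j, bhattGap d (transM q p) Δ (m + 1) i j with hG
  set C := |G 0| + 1 with hC
  have hC0 : 0 < C := by positivity
  have hdecay : ∀ m, G m ≤ C * (1 / 2) ^ m := by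
    intro m
    induction m with
    | zero => have := le_abs_self (G 0); simp; linarith
    | succ m ih =>
      have := sum_bhattGap_succ_le hq hp hp1 hlam hΔ0 hrow hcol hdiag hd hd' m
      rw [pow_succ]
      change G (m + 1) ≤ 1 / 2 * G m at this
      linarith
  rw [← tendsto_add_atTop_iff_nat 1]
  refine squeeze_zero (g := fun m => √(C * (1 / 2) ^ m) * (1 + 2 * q)) (fun m => ?_)
    (fun m => ?_) ?_
  · exact sub_nonneg.2 (sum_iSup_channel_le (leafNoise_nonneg hΔ0 (m + 1))
      (sum_leafNoise hrow (m + 1)) (leafLik_channel (m + 1)))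
  · have hpos : 0 < C * (1 / 2) ^ m := by positivity
    have hs := Real.sqrt_pos.2 hpos
    have h := sum_iSup_sub_le (leafLik_nonneg (d := d) hM0 hI0 (m + 1))
      (sum_leafLik (sum_transM hq p) hI1 (m + 1))
      (leafLik_succ_pos hM hΔ0 (fun c => by rw [hcol]; norm_num) m)
      (leafNoise_nonneg hΔ0 (m + 1)) (sum_leafNoise hrow (m + 1)) (leafLik_channel (m + 1)) hs
    refine h.trans ?_
    rw [Fintype.card_fin]
    have h2 : G m / √(C * (1 / 2) ^ m) ≤ √(C * (1 / 2) ^ m) := by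
      rw [div_le_iff₀ hs, Real.mul_self_sqrt hpos.le]
      exact hdecay m
    change G m / _ + _ ≤ _
    linarith
  · have h1 : Tendsto (fun m : ℕ => C * (1 / 2 : ℝ) ^ m) atTop (nhds 0) := by
      simpa using (tendsto_pow_atTop_nhds_zero_of_lt_one (by norm_num : (0 : ℝ) ≤ 1 / 2)
        (by norm_num)).const_mul C
    simpa using (h1.sqrt).mul_const (1 + 2 * (q : ℝ))

theorem tendsto_sum_iSup_leafLik_one {q : ℕ} (hq : 3 ≤ q) {p : ℝ} (hp : 0 < p)
    (hp1 : p < 1) {B : Fin q → Fin q → ℝ} (hB0 : ∀ i j, 0 ≤ B i j)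
    (hB1 : ∀ i, ∑ j, B i j = 1) :
    Tendsto (fun m : ℕ =>
      ∑ a : (Fin m → Fin 1) → Fin q, ⨆ i, leafLik (transM q p) B m i a) atTop (nhds 1) := by
  have hM := transM_pos hq hp hp1
  have hM0 : ∀ i c, 0 ≤ transM q p i c := fun i c => (hM i c).le
  have h0 := leafLik_nonneg (d := 1) hM0 hB0
  have h1 := sum_leafLik (d := 1) (sum_transM hq p) hB1
  have : Nonempty (Fin q) := ⟨⟨0, by omega⟩⟩
  set lam := 1 - p * q / ((q : ℝ) - 1) with hlam
  have hlam1 : |lam| < 1 := by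
    have : (3 : ℝ) ≤ q := by exact_mod_cast hq
    have hq1 : (0 : ℝ) < q - 1 := by linarith
    have e : p * q / ((q : ℝ) - 1) < 2 := by
      rw [div_lt_iff₀ hq1]; nlinarith
    have e' : 0 < p * q / ((q : ℝ) - 1) := by positivity
    rw [abs_lt]
    constructor <;> linarith
  have hL : ∀ m i j, ∑ a : (Fin m → Fin 1) → Fin q,
      |leafLik (transM q p) B m i a - leafLik (transM q p) B m j a| ≤ 2 * |lam| ^ m := by
    intro m
    induction m with
    | zero =>
      intro i j
      have : ∀ a, |leafLik (d := 1) (transM q p) B 0 i a - leafLik (transM q p) B 0 j a| ≤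
          leafLik (transM q p) B 0 i a + leafLik (transM q p) B 0 j a := fun a => by
        rw [abs_le]; constructor <;> linarith [h0 0 i a, h0 0 j a]
      refine (Finset.sum_le_sum fun a _ => this a).trans ?_
      rw [Finset.sum_add_distrib, h1, h1]
      norm_num
    | succ m ih =>
      intro i j
      have e : ∑ a : (Fin (m + 1) → Fin 1) → Fin q,
          |leafLik (transM q p) B (m + 1) i a - leafLik (transM q p) B (m + 1) j a| =
          ∑ a, |mixRows (transM q p) (leafLik (d := 1) (transM q p) B m) i a
            - mixRows (transM q p) (leafLik (transM q p) B m) j a| := by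
        simp only [leafLik, Fin.prod_univ_one]
        exact Fintype.sum_equiv ((leafSplit q 1 m).trans (Equiv.funUnique (Fin 1) _)) _ _
          fun a => rfl
      rw [e, sum_abs_mixRows_transM_sub hq, ← hlam, pow_succ]
      nlinarith [ih i j, abs_nonneg lam]
  let c₀ : Fin q := Classical.arbitrary _
  refine tendsto_of_tendsto_of_tendsto_of_le_of_le (g := fun _ => 1)
    (h := fun m => 1 + q * (2 * |lam| ^ m)) tendsto_const_nhds ?_ (fun m => ?_) (fun m => ?_)
  · have := tendsto_pow_atTop_nhds_zero_of_lt_one (abs_nonneg lam) hlam1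
    simpa using ((this.const_mul 2).const_mul (q : ℝ)).const_add 1
  · change 1 ≤ _
    rw [← h1 m c₀]
    exact Finset.sum_le_sum fun a _ =>
      le_ciSup (f := fun i => leafLik (transM q p) B m i a) (Set.finite_range _).bddAbove c₀
  · calc ∑ a : (Fin m → Fin 1) → Fin q, ⨆ i, leafLik (transM q p) B m i a
        ≤ ∑ a : (Fin m → Fin 1) → Fin q, (leafLik (transM q p) B m c₀ a + ∑ i,
          |leafLik (transM q p) B m i a - leafLik (transM q p) B m c₀ a|) := by
          refine Finset.sum_le_sum fun a _ => ciSup_le fun i => ?_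
          have h2 := Finset.single_le_sum
            (f := fun i => |leafLik (transM q p) B m i a - leafLik (transM q p) B m c₀ a|)
            (fun _ _ => abs_nonneg _) (Finset.mem_univ i)
          have h3 := le_abs_self (leafLik (transM q p) B m i a - leafLik (transM q p) B m c₀ a)
          linarith
      _ ≤ 1 + ∑ _i : Fin q, 2 * |lam| ^ m := by
          rw [Finset.sum_add_distrib, h1, Finset.sum_comm]
          gcongr with i
          exact hL m i c₀
      _ = _ := by simp

theorem exp_bounds_of_log_lt {q d : ℕ} (hq : 3 ≤ q) (hd : 2 ≤ d) {lam : ℝ}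
    (h : 36 * (2 * q + 2) * Real.log d < lam ^ 2 * d) :
    Real.exp (-(lam ^ 2 / 18)) ^ d ≤ 1 / 2 ∧
      (q : ℝ) ^ 2 * (d * Real.exp (-(lam ^ 2 / 18)) ^ (d - 1)) ≤ 1 / 2 := by
  have hd2 : (2 : ℝ) ≤ d := by exact_mod_cast hd
  have hq3 : (3 : ℝ) ≤ q := by exact_mod_cast hq
  have hd0 : (0 : ℝ) < d := by linarith
  set κ := Real.exp (-(lam ^ 2 / 18)) with hκ
  have hκ1 : κ ≤ 1 := Real.exp_le_one_iff.2 (by nlinarith [sq_nonneg lam])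
  have hκ0 : 0 < κ := Real.exp_pos _
  have e1 : κ ^ (d - 1) ≤ ((d : ℝ) ^ (2 * q + 2))⁻¹ := by
    rw [hκ, ← Real.exp_nat_mul, Nat.cast_sub (by omega : 1 ≤ d), ← Real.exp_log hd0,
      ← Real.exp_nat_mul, ← Real.exp_neg, Real.exp_le_exp, Real.exp_log hd0]
    push_cast
    nlinarith [sq_nonneg lam]
  have e2 : (q : ℝ) ^ 2 * (d * κ ^ (d - 1)) ≤ 1 / 2 := by
    have hq2 : (q : ℝ) ≤ 2 ^ q := by exact_mod_cast Nat.lt_two_pow_self.le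
    have hq2d : (q : ℝ) ≤ (d : ℝ) ^ q := hq2.trans (pow_le_pow_left₀ (by norm_num) hd2 q)
    calc (q : ℝ) ^ 2 * (d * κ ^ (d - 1)) ≤ ((d : ℝ) ^ q) ^ 2 * (d * ((d : ℝ) ^ (2 * q + 2))⁻¹) := by
          gcongr
      _ = (d : ℝ)⁻¹ := by
          field_simp
          ring
      _ ≤ 1 / 2 := by
          rw [one_div]; exact inv_anti₀ (by norm_num) hd2
  refine ⟨?_, e2⟩
  have e3 : κ ^ d ≤ κ ^ (d - 1) := pow_le_pow_of_le_one hκ0.le hκ1 (by omega)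
  have e4 : κ ^ (d - 1) ≤ (q : ℝ) ^ 2 * (d * κ ^ (d - 1)) := by
    have : 0 ≤ κ ^ (d - 1) := by positivity
    rw [← mul_assoc]
    exact le_mul_of_one_le_left this (by nlinarith)
  linarith

/-- For a finitely valued observation `Y`, the expected maximal posterior probability is the sum
over the observations of the maximal joint probability. -/
theorem integral_iSup_condExp_comap {Ω Y ι : Type*} [MeasurableSpace Ω] {μ : Measure Ω}
    [IsFiniteMeasure μ] [Fintype Y] [Nonempty Y] [MeasurableSpace Y]
    [MeasurableSingletonClass Y] [Finite ι]
    {obs : Ω → Y} (hobs : Measurable obs) {S : ι → Set Ω} (hS : ∀ i, MeasurableSet (S i)) :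
    ∫ ω, ⨆ i, (μ[Set.indicator (S i) (fun _ => (1 : ℝ)) |
      MeasurableSpace.comap obs inferInstance]) ω ∂μ =
      ∑ y, ⨆ i, μ.real (S i ∩ obs ⁻¹' {y}) := by
  have hm : MeasurableSpace.comap obs inferInstance ≤ (inferInstance : MeasurableSpace Ω) :=
    hobs.comap_le
  have hφ : ∀ i, ∃ φ : Y → ℝ, μ[Set.indicator (S i) (fun _ => (1 : ℝ)) |
      MeasurableSpace.comap obs inferInstance] = φ ∘ obs := fun i =>
    (Function.factorsThrough_iff _).1 stronglyMeasurable_condExp.factorsThrough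
  choose φ hφ using hφ
  have hjoint : ∀ i y, φ i y * μ.real (obs ⁻¹' {y}) = μ.real (S i ∩ obs ⁻¹' {y}) := by
    intro i y
    have hy : MeasurableSet[MeasurableSpace.comap obs inferInstance] (obs ⁻¹' {y}) :=
      ⟨{y}, measurableSet_singleton y, rfl⟩
    have h := setIntegral_condExp hm
      ((integrable_const (μ := μ) (1 : ℝ)).indicator (hS i)) hy
    rw [hφ i, setIntegral_indicator (hS i), setIntegral_const] at h
    rw [setIntegral_congr_fun (g := fun _ => φ i y) (hm _ hy)
      (fun ω (hω : obs ω = y) => by simp [hω]), setIntegral_const] at h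
    rw [Set.inter_comm (S i)]
    simpa [mul_comm] using h
  simp only [hφ, Function.comp_apply]
  have hint := integral_map (μ := μ) hobs.aemeasurable (f := fun y => ⨆ i, φ i y)
    (measurable_of_countable _).aestronglyMeasurable
  rw [← hint]
  rw [integral_fintype (Integrable.of_finite)]
  refine Finset.sum_congr rfl fun y _ => ?_
  rw [map_measureReal_apply hobs (measurableSet_singleton y), smul_eq_mul,
    Real.mul_iSup_of_nonneg measureReal_nonneg]
  exact iSup_congr fun i => by rw [mul_comm, hjoint]

section

variable {q d : ℕ}

/-- The probability weight of the clean and noisy labels `x` on the first `k` levels. -/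
noncomputable def prefixWeight (M Δ : Fin q → Fin q → ℝ) (k : ℕ)
    (x : List (Fin d) → Fin q × Fin q) : ℝ :=
  (q : ℝ)⁻¹ *
    (∏ j ∈ Finset.range k, ∏ f : Fin j → Fin d, ∏ i : Fin d,
      M (x (List.ofFn f)).1 (x (i :: List.ofFn f)).1) *
    ∏ j ∈ Finset.range (k + 1), ∏ f : Fin j → Fin d, Δ (x (List.ofFn f)).1 (x (List.ofFn f)).2

/-- The conditional probability, given that the clean and noisy labels of the vertex `v` are `x`,
that the labels of all descendants `w` of `v` at relative depth `n` lie in `R w`. -/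
noncomputable def descWeight (M Δ : Fin q → Fin q → ℝ) (R : List (Fin d) → Set (Fin q × Fin q)) :
    ℕ → List (Fin d) → Fin q × Fin q → ℝ
  | 0, v, x => (R v).indicator (fun _ => 1) x
  | n + 1, v, x => ∏ i : Fin d, ∑ y : Fin q × Fin q,
      M x.1 y.1 * Δ y.1 y.2 * descWeight M Δ R n (i :: v) y

/-- The labelling agreeing with `γ` at depth `k` and with `x` elsewhere. -/
def setLevel {α : Type*} (k : ℕ) (x : List (Fin d) → α) (γ : (Fin k → Fin d) → α)
    (v : List (Fin d)) : α :=
  if h : v.length = k then γ fun i => v.get (i.cast h.symm) else x v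

theorem setLevel_ofFn {α : Type*} (k : ℕ) (x : List (Fin d) → α) (γ : (Fin k → Fin d) → α)
    (f : Fin k → Fin d) : setLevel k x γ (List.ofFn f) = γ f := by
  rw [setLevel, dif_pos List.length_ofFn]
  congr 1
  ext i
  simp

theorem setLevel_of_ne {α : Type*} {k : ℕ} (x : List (Fin d) → α) (γ : (Fin k → Fin d) → α)
    {v : List (Fin d)} (hv : v.length ≠ k) : setLevel k x γ v = x v := dif_neg hv

theorem forall_length_eq_iff {k : ℕ} {p : List (Fin d) → Prop} :
    (∀ v : List (Fin d), v.length = k → p v) ↔ ∀ f : Fin k → Fin d, p (List.ofFn f) := by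
  constructor
  · exact fun h f => h _ List.length_ofFn
  · rintro h v rfl
    simpa using h v.get

theorem prod_cons {k : ℕ} (F : (Fin (k + 1) → Fin d) → ℝ) :
    ∏ g, F g = ∏ f : Fin k → Fin d, ∏ i : Fin d, F (Fin.cons (α := fun _ => Fin d) i f) := by
  rw [← Fintype.prod_equiv (Fin.consEquiv fun _ : Fin (k + 1) => Fin d)
    (fun x => F (Fin.cons x.1 x.2)) F fun x => rfl, Fintype.prod_prod_type_right]

theorem prefixWeight_succ (M Δ : Fin q → Fin q → ℝ) (k : ℕ) (x : List (Fin d) → Fin q × Fin q)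
    (γ : (Fin (k + 1) → Fin d) → Fin q × Fin q) :
    prefixWeight M Δ (k + 1) (setLevel (k + 1) x γ) = prefixWeight M Δ k x *
      ∏ g, M (x (List.ofFn (Fin.tail g))).1 (γ g).1 * Δ (γ g).1 (γ g).2 := by
  have hlt : ∀ {j : ℕ}, j < k + 1 → ∀ f : Fin j → Fin d,
      setLevel (k + 1) x γ (List.ofFn f) = x (List.ofFn f) := fun hj f =>
    setLevel_of_ne x γ (by rw [List.length_ofFn]; omega)
  have hcons : ∀ {j : ℕ}, j < k → ∀ (f : Fin j → Fin d) (i : Fin d),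
      setLevel (k + 1) x γ (i :: List.ofFn f) = x (i :: List.ofFn f) := fun hj f i =>
    setLevel_of_ne x γ (by rw [List.length_cons, List.length_ofFn]; omega)
  have hlast : ∀ (f : Fin k → Fin d) (i : Fin d),
      setLevel (k + 1) x γ (i :: List.ofFn f) = γ (Fin.cons (α := fun _ => Fin d) i f) :=
    fun f i => by rw [← List.ofFn_cons, setLevel_ofFn]
  have e1 : ∏ j ∈ Finset.range k, ∏ f : Fin j → Fin d, ∏ i : Fin d,
      M (setLevel (k + 1) x γ (List.ofFn f)).1 (setLevel (k + 1) x γ (i :: List.ofFn f)).1 =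
      ∏ j ∈ Finset.range k, ∏ f : Fin j → Fin d, ∏ i : Fin d,
      M (x (List.ofFn f)).1 (x (i :: List.ofFn f)).1 := by
    refine Finset.prod_congr rfl fun j hj => ?_
    have hj := Finset.mem_range.1 hj
    simp only [hlt (hj.trans (Nat.lt_succ_self k)), hcons hj]
  have e2 : ∏ j ∈ Finset.range (k + 1), ∏ f : Fin j → Fin d,
      Δ (setLevel (k + 1) x γ (List.ofFn f)).1 (setLevel (k + 1) x γ (List.ofFn f)).2 =
      ∏ j ∈ Finset.range (k + 1), ∏ f : Fin j → Fin d,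
      Δ (x (List.ofFn f)).1 (x (List.ofFn f)).2 := by
    refine Finset.prod_congr rfl fun j hj => ?_
    simp only [hlt (Finset.mem_range.1 hj)]
  unfold prefixWeight
  rw [Finset.prod_range_succ _ k, Finset.prod_range_succ _ (k + 1), e1, e2,
    Finset.prod_mul_distrib, prod_cons fun g => M (x (List.ofFn (Fin.tail g))).1 (γ g).1]
  simp only [hlt (Nat.lt_succ_self k), hlast, setLevel_ofFn, Fin.tail_cons]
  ring

theorem measureReal_eq_sum_inter {Ω Y : Type*} [MeasurableSpace Ω] (μ : Measure Ω)
    [IsFiniteMeasure μ] [Fintype Y] [MeasurableSpace Y] [MeasurableSingletonClass Y]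
    {obs : Ω → Y} (hobs : Measurable obs) (S : Set Ω) :
    μ.real S = ∑ y, μ.real (S ∩ obs ⁻¹' {y}) := by
  have h := sum_measureReal_preimage_singleton (μ := μ.restrict S) Finset.univ (f := obs)
    fun y _ => hobs (measurableSet_singleton y)
  rw [Finset.coe_univ, Set.preimage_univ, measureReal_restrict_apply_univ] at h
  rw [← h]
  refine Finset.sum_congr rfl fun y _ => ?_
  rw [measureReal_restrict_apply (hobs (measurableSet_singleton y)), Set.inter_comm]

variable {Ω : Type*} [MeasurableSpace Ω] {μ : Measure Ω} [IsProbabilityMeasure μ]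
  {Z : List (Fin d) → Ω → Fin q × Fin q} {M Δ : Fin q → Fin q → ℝ}

theorem measureReal_prefix_inter_level (hZ : ∀ v, Measurable (Z v))
    (hlaw : ∀ k x, μ.real {ω | ∀ v : List (Fin d), v.length ≤ k → Z v ω = x v} =
      prefixWeight M Δ k x)
    (R : List (Fin d) → Set (Fin q × Fin q)) (n : ℕ) {k N : ℕ} (hN : N = k + n)
    (x : List (Fin d) → Fin q × Fin q) :
    μ.real {ω | (∀ v : List (Fin d), v.length ≤ k → Z v ω = x v) ∧
      ∀ f : Fin N → Fin d, Z (List.ofFn f) ω ∈ R (List.ofFn f)} =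
    prefixWeight M Δ k x *
      ∏ f : Fin k → Fin d, descWeight M Δ R n (List.ofFn f) (x (List.ofFn f)) := by
  classical
  induction n generalizing k x with
  | zero =>
    obtain rfl : N = k := hN
    have key : ∀ ω, (∀ v : List (Fin d), v.length ≤ N → Z v ω = x v) →
        ((∀ f : Fin N → Fin d, Z (List.ofFn f) ω ∈ R (List.ofFn f)) ↔
          ∀ f : Fin N → Fin d, x (List.ofFn f) ∈ R (List.ofFn f)) := fun ω hω =>
      forall_congr' fun f => by rw [hω _ List.length_ofFn.le]
    simp only [descWeight]
    by_cases hR : ∀ f : Fin N → Fin d, x (List.ofFn f) ∈ R (List.ofFn f)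
    · rw [Finset.prod_eq_one fun f _ => Set.indicator_of_mem (hR f) _, mul_one, ← hlaw]
      congr 1
      ext ω
      exact ⟨fun h => h.1, fun h => ⟨h, (key ω h).2 hR⟩⟩
    · obtain ⟨f, hf⟩ := not_forall.1 hR
      rw [Finset.prod_eq_zero (Finset.mem_univ f) (Set.indicator_of_notMem hf _), mul_zero]
      convert measureReal_empty
      ext ω
      simp only [Set.mem_ofPred_eq, Set.mem_empty_iff_false, iff_false]
      exact fun h => hR ((key ω h.1).1 h.2)
  | succ n ih =>
    rw [measureReal_eq_sum_inter μ
      (obs := fun ω (g : Fin (k + 1) → Fin d) => Z (List.ofFn g) ω)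
      (measurable_pi_lambda _ fun g => hZ _)]
    have hset : ∀ γ : (Fin (k + 1) → Fin d) → Fin q × Fin q,
        {ω | (∀ v : List (Fin d), v.length ≤ k → Z v ω = x v) ∧
          ∀ f : Fin N → Fin d, Z (List.ofFn f) ω ∈ R (List.ofFn f)} ∩
          (fun ω (g : Fin (k + 1) → Fin d) => Z (List.ofFn g) ω) ⁻¹' {γ} =
        {ω | (∀ v : List (Fin d), v.length ≤ k + 1 → Z v ω = setLevel (k + 1) x γ v) ∧
          ∀ f : Fin N → Fin d, Z (List.ofFn f) ω ∈ R (List.ofFn f)} := by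
      intro γ
      ext ω
      have h1 : (∀ v : List (Fin d), v.length ≤ k + 1 → Z v ω = setLevel (k + 1) x γ v) ↔
          (∀ v : List (Fin d), v.length ≤ k → Z v ω = x v) ∧
            ∀ g : Fin (k + 1) → Fin d, Z (List.ofFn g) ω = γ g := by
        constructor
        · intro h
          refine ⟨fun v hv => ?_, fun g => ?_⟩
          · rw [h v (by omega), setLevel_of_ne x γ (by omega)]
          · rw [h _ List.length_ofFn.le, setLevel_ofFn]
        · rintro ⟨h, h'⟩ v hv
          rcases Nat.lt_or_ge k v.length with hlt | hle
          · refine (forall_length_eq_iff (k := k + 1)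
              (p := fun v => Z v ω = setLevel (k + 1) x γ v)).2
              (fun g => ?_) v (by omega)
            rw [h' g, setLevel_ofFn]
          · rw [h v hle, setLevel_of_ne x γ (by omega)]
      simp only [Set.mem_inter_iff, Set.mem_ofPred_eq, Set.mem_preimage, Set.mem_singleton_iff,
        funext_iff, h1]
      tauto
    simp only [hset, ih (k := k + 1) (by omega : N = k + 1 + n), prefixWeight_succ, setLevel_ofFn,
      mul_assoc, ← Finset.prod_mul_distrib, ← Finset.mul_sum]
    congr 1
    rw [← Fintype.prod_sum fun g (y : Fin q × Fin q) =>
      M (x (List.ofFn (Fin.tail g))).1 y.1 * (Δ y.1 y.2 * descWeight M Δ R n (List.ofFn g) y),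
      prod_cons]
    simp only [descWeight, List.ofFn_cons, Fin.tail_cons, mul_assoc]

theorem rowSum_eq_one_of_law (hd : 1 ≤ d) (hZ : ∀ v, Measurable (Z v))
    (hlaw : ∀ k x, μ.real {ω | ∀ v : List (Fin d), v.length ≤ k → Z v ω = x v} =
      prefixWeight M Δ k x) (hM : ∀ i c, 0 ≤ M i c) (hΔ0 : ∀ i j, 0 ≤ Δ i j) {c : Fin q}
    (hc : 0 < Δ c c) : ∑ c', M c c' * ∑ t, Δ c' t = 1 := by
  have h0 := hlaw 0 fun _ => (c, c)
  have h1 := measureReal_prefix_inter_level hZ hlaw (fun _ => Set.univ) 1 (k := 0) rfl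
    fun _ => (c, c)
  simp only [Set.mem_univ, implies_true, and_true, h0] at h1
  have hq : (q : ℝ) ≠ 0 := by
    have := c.pos
    positivity
  have hpos : prefixWeight M Δ 0 (fun _ : List (Fin d) => (c, c)) ≠ 0 := by
    simp [prefixWeight, hc.ne', hq]
  have h2 := mul_left_cancel₀ hpos (h1.symm.trans (mul_one _).symm)
  simp only [descWeight, Set.indicator_univ, mul_one, Fintype.prod_unique] at h2
  simp only [Finset.prod_const, Finset.card_univ, Fintype.card_fin, Fintype.sum_prod_type,
    ← Finset.mul_sum] at h2
  refine (pow_eq_one_iff_of_nonneg (Finset.sum_nonneg fun c' _ => mul_nonneg (hM _ _)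
    (Finset.sum_nonneg fun t _ => hΔ0 _ _)) (by omega)).1 h2

theorem sum_mul_descWeight (hrow : ∀ i, ∑ j, Δ i j = 1) (proj : Fin q × Fin q → Fin q)
    (A : List (Fin d) → Fin q) (n : ℕ) (v : List (Fin d)) (c : Fin q) :
    ∑ t, Δ c t * descWeight M Δ (fun v => {x | proj x = A v}) n v (c, t) =
      leafLik M (fun c y => ∑ t, Δ c t * if proj (c, t) = y then 1 else 0) n c
        (fun f => A (List.ofFn f ++ v)) := by
  induction n generalizing v c with
  | zero => simp [descWeight, leafLik, Set.indicator_apply]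
  | succ n ih =>
    simp only [descWeight, ← Finset.sum_mul, hrow, one_mul, leafLik, mixRows]
    refine Finset.prod_congr rfl fun i _ => ?_
    rw [Fintype.sum_prod_type]
    refine Finset.sum_congr rfl fun c' _ => ?_
    simp only [mul_assoc, ← Finset.mul_sum]
    rw [ih]
    congr 2
    funext f
    rw [List.ofFn_succ']
    simp

theorem measureReal_root_inter_leaves (hZ : ∀ v, Measurable (Z v))
    (hlaw : ∀ k x, μ.real {ω | ∀ v : List (Fin d), v.length ≤ k → Z v ω = x v} =
      prefixWeight M Δ k x) (hrow : ∀ i, ∑ j, Δ i j = 1) (proj : Fin q × Fin q → Fin q)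
    (m : ℕ) (c : Fin q) (a : (Fin m → Fin d) → Fin q) :
    μ.real ({ω | (Z [] ω).1 = c} ∩
      (fun ω (f : Fin m → Fin d) => proj (Z (List.ofFn f) ω)) ⁻¹' {a}) =
      (q : ℝ)⁻¹ * leafLik M (fun c y => ∑ t, Δ c t * if proj (c, t) = y then 1 else 0) m c a := by
  rw [measureReal_eq_sum_inter μ (obs := fun ω => (Z [] ω).2) (measurable_snd.comp (hZ []))]
  set A : List (Fin d) → Fin q := setLevel m (fun _ => c) a with hA
  have hset : ∀ t : Fin q, ({ω | (Z [] ω).1 = c} ∩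
      (fun ω (f : Fin m → Fin d) => proj (Z (List.ofFn f) ω)) ⁻¹' {a}) ∩
      (fun ω => (Z [] ω).2) ⁻¹' {t} =
      {ω | (∀ v : List (Fin d), v.length ≤ 0 → Z v ω = (c, t)) ∧
        ∀ f : Fin m → Fin d, Z (List.ofFn f) ω ∈ {x | proj x = A (List.ofFn f)}} := by
    intro t
    ext ω
    simp only [hA, setLevel_ofFn, Set.mem_inter_iff, Set.mem_ofPred_eq, Set.mem_preimage,
      Set.mem_singleton_iff, funext_iff, Nat.le_zero, List.length_eq_zero_iff, forall_eq,
      Prod.ext_iff]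
    tauto
  have h := sum_mul_descWeight (M := M) hrow proj A m [] c
  simp only [List.append_nil, hA, setLevel_ofFn] at h
  rw [← h, Finset.mul_sum]
  refine Finset.sum_congr rfl fun t _ => ?_
  rw [hset, measureReal_prefix_inter_level hZ hlaw (fun v => {x | proj x = A v}) m (k := 0)
    (zero_add m).symm fun _ => (c, t)]
  simp [prefixWeight, hA, mul_assoc]

end

section

variable {q d : ℕ} {Ω : Type} [MeasurableSpace Ω] {μ : Measure Ω} [IsProbabilityMeasure μ]
  {Z : List (Fin d) → Ω → Fin q × Fin q} {M Δ : Fin q → Fin q → ℝ}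

theorem rowSum_eq_one_of_transM_mul {p : ℝ} (hq : 3 ≤ q) {r : Fin q → ℝ}
    (h : ∀ c, ∑ c', transM q p c c' * r c' = 1) (hr : ∑ c, r c = q)
    (hlam : 1 - p * q / ((q : ℝ) - 1) ≠ 0) (c : Fin q) : r c = 1 := by
  have hq' : (3 : ℝ) ≤ q := by exact_mod_cast hq
  have h1 : (1 - p * q / ((q : ℝ) - 1)) * r c + p / ((q : ℝ) - 1) * ∑ c, r c = 1 := by
    exact (mixRows_transM hq p (fun c (_ : Unit) => r c) c ()).symm.trans (h c)
  have h2 : (1 - p * q / ((q : ℝ) - 1)) * (r c - 1) = 0 := by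
    rw [hr] at h1
    linear_combination h1
  exact sub_eq_zero.1 ((mul_eq_zero.1 h2).resolve_left hlam)

theorem optRecon_eq_sum_iSup_leafLik (hq : 1 ≤ q) (hZ : ∀ v, Measurable (Z v))
    (hlaw : ∀ k x, μ.real {ω | ∀ v : List (Fin d), v.length ≤ k → Z v ω = x v} =
      prefixWeight M Δ k x) (hrow : ∀ i, ∑ j, Δ i j = 1) (proj : Fin q × Fin q → Fin q)
    (m : ℕ) : optRecon μ (fun ω => (Z [] ω).1) (fun v ω => proj (Z v ω)) m =
      (q : ℝ)⁻¹ * ∑ a : (Fin m → Fin d) → Fin q,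
        ⨆ i, leafLik M (fun c y => ∑ t, Δ c t * if proj (c, t) = y then 1 else 0) m i a := by
  have : Nonempty (Fin q) := ⟨⟨0, hq⟩⟩
  unfold optRecon _root_.posterior leafAlg
  refine (integral_iSup_condExp_comap (S := fun i => {ω | (Z [] ω).1 = i})
    (obs := fun ω (f : Fin m → Fin d) => proj (Z (List.ofFn f) ω))
    (measurable_pi_lambda _ fun f => (measurable_of_finite proj).comp (hZ _))
    fun i => measurable_fst.comp (hZ []) (measurableSet_singleton i)).trans ?_
  rw [Finset.mul_sum]
  refine Finset.sum_congr rfl fun a _ => ?_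
  rw [Real.mul_iSup_of_nonneg (by positivity)]
  exact iSup_congr fun i => measureReal_root_inter_leaves hZ hlaw hrow proj m i a

end

/-- If `λ ≤ 1−ξ` and `λ²d > C*(q,ξ)·log d`, then
`lim_{m→∞} |E_m − Ẽ_m| = 0`: the optimal probabilities of reconstructing the root from the
exact and from the noisy depth-`m` labels have the same limit. -/
theorem broadcast_optRecon_same_limit_logd (ξ : ℝ) (hξ : 0 < ξ) (q : ℕ) (hq : 3 ≤ q) :
    ∃ Cstar : ℝ, 0 < Cstar ∧
      ∀ (d : ℕ), 1 ≤ d →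
      ∀ (p : ℝ), 0 < p → p < 1 →
      ∀ (Ω : Type) [MeasurableSpace Ω] (μ : Measure Ω) [IsProbabilityMeasure μ]
        (σ τ : List (Fin d) → Ω → Fin q),
        (∀ v, Measurable (σ v)) → (∀ v, Measurable (τ v)) →
      ∀ (Δ : Fin q → Fin q → ℝ),
        (∀ i j, 0 ≤ Δ i j ∧ Δ i j ≤ 1) →
        (∀ j, ∑ i : Fin q, Δ i j = 1) →
        (∀ i, 1 - 1 / (q : ℝ) ≤ Δ i i) →
        (∀ (k : ℕ) (ℓ t : List (Fin d) → Fin q),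
          (μ {ω | ∀ v : List (Fin d), v.length ≤ k → σ v ω = ℓ v ∧ τ v ω = t v}).toReal
            = ((q : ℝ))⁻¹ *
              (∏ j ∈ Finset.range k, ∏ f : Fin j → Fin d, ∏ i : Fin d,
                transM q p (ℓ (List.ofFn f)) (ℓ (i :: List.ofFn f))) *
              ∏ j ∈ Finset.range (k + 1), ∏ f : Fin j → Fin d,
                Δ (ℓ (List.ofFn f)) (t (List.ofFn f))) →
      ∀ (lam : ℝ), lam = 1 - p * q / ((q : ℝ) - 1) → lam ≤ 1 - ξ →
        lam ^ 2 * d > Cstar * Real.log d →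
        Filter.Tendsto
          (fun m : ℕ => |optRecon μ (σ []) σ m - optRecon μ (σ []) τ m|)
          Filter.atTop (nhds 0) := by
  have hq' : (3 : ℝ) ≤ q := by exact_mod_cast hq
  refine ⟨36 * (2 * q + 2), by positivity, ?_⟩
  intro d hd p hp hp1 Ω _ μ _ σ τ hσ hτ Δ hΔ hcol hdiag hlaw lam hlam _ hbig
  have hΔ0 : ∀ i j, 0 ≤ Δ i j := fun i j => (hΔ i j).1
  let Z : List (Fin d) → Ω → Fin q × Fin q := fun v ω => (σ v ω, τ v ω)
  have hZ : ∀ v, Measurable (Z v) := fun v => (hσ v).prodMk (hτ v)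
  have hlawZ : ∀ k x, μ.real {ω | ∀ v : List (Fin d), v.length ≤ k → Z v ω = x v} =
      prefixWeight (transM q p) Δ k x := fun k x => by
    refine Eq.trans ?_ (hlaw k (fun v => (x v).1) fun v => (x v).2)
    simp only [Z, Prod.ext_iff, Measure.real]
  have hlam0 : lam ≠ 0 := by
    rintro rfl
    have hlog : 0 ≤ Real.log d := Real.log_natCast_nonneg d
    have : 0 ≤ 36 * (2 * (q : ℝ) + 2) * Real.log d := by positivity
    simp only [gt_iff_lt, ne_eq, OfNat.ofNat_ne_zero, not_false_eq_true, zero_pow, zero_mul] at hbig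
    exact absurd this hbig.not_ge
  have hpos : ∀ c, 0 < Δ c c := fun c =>
    lt_of_lt_of_le (sub_pos.2 ((div_lt_one (by linarith)).2 (by linarith))) (hdiag c)
  have hrow : ∀ i, ∑ j, Δ i j = 1 := rowSum_eq_one_of_transM_mul hq
    (fun c => rowSum_eq_one_of_law hd hZ hlawZ (fun i c => (transM_pos hq hp hp1 i c).le) hΔ0
      (hpos c))
    (by rw [Finset.sum_comm]; simp [hcol]) (hlam ▸ hlam0)
  have hE : ∀ m, optRecon μ (σ []) σ m = (q : ℝ)⁻¹ * ∑ a : (Fin m → Fin d) → Fin q,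
      ⨆ i, leafLik (transM q p) (fun i j => if i = j then 1 else 0) m i a := fun m => by
    have h := optRecon_eq_sum_iSup_leafLik (by omega) hZ hlawZ hrow Prod.fst m
    have hB : (fun c y : Fin q => ∑ t, Δ c t * if (c, t).1 = y then (1 : ℝ) else 0) =
        fun i j => if i = j then 1 else 0 := by
      funext c y
      by_cases hcy : c = y <;> simp [hcy, hrow]
    rwa [hB] at h
  have hE' : ∀ m, optRecon μ (σ []) τ m = (q : ℝ)⁻¹ * ∑ a : (Fin m → Fin d) → Fin q,
      ⨆ i, leafLik (transM q p) Δ m i a := fun m => by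
    have h := optRecon_eq_sum_iSup_leafLik (by omega) hZ hlawZ hrow Prod.snd m
    simpa only [mul_ite, mul_one, mul_zero, Finset.sum_ite_eq', Finset.mem_univ, if_true] using h
  simp only [hE, hE', ← mul_sub]
  suffices h : Tendsto (fun m : ℕ =>
      (∑ a : (Fin m → Fin d) → Fin q,
          ⨆ i, leafLik (transM q p) (fun i j => if i = j then 1 else 0) m i a) -
        ∑ a : (Fin m → Fin d) → Fin q, ⨆ i, leafLik (transM q p) Δ m i a) atTop (nhds 0) by
    have h' := (h.const_mul (q : ℝ)⁻¹).abs
    rwa [mul_zero, abs_zero] at h'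
  rcases hd.eq_or_lt with rfl | hd2
  · have h := tendsto_sum_iSup_leafLik_one hq hp hp1 (B := fun i j => if i = j then 1 else 0)
      (fun i j => by split_ifs <;> norm_num) (fun i => by simp)
    have h' := h.sub (tendsto_sum_iSup_leafLik_one hq hp hp1 hΔ0 hrow)
    rwa [sub_self] at h'
  · obtain ⟨h1, h2⟩ := exp_bounds_of_log_lt hq hd2 hbig
    exact tendsto_sum_iSup_leafLik_sub hq hp hp1 hlam hΔ0 hrow hcol hdiag h1 h2
end
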